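/- There exists a universal probability m such that, for every computable real number q > 1, the real number ∑_{s∈{0,1}*} m(s)^q is weakly Chaitin random (∃c ∀n, K of its first n binary digits ≥ n - c), and hence not 1/q-compressible. -/

import Mathlib

open Filter Topology

namespace Paper

/-- Finite binary strings. -/
abbrev Str := List Bool

/-- A computer: a partial recursive function on binary strings with prefix-free domain. -/
structure Computer where
  f : Str →. Str
  partrec : Partrec f
  prefixFree : ∀ p q : Str, (f p).Dom → (f q).Dom → p <+: q → p = q

/-- An optimal computer (universal self-delimiting Turing machine). -/
structure OptimalComputer extends Computer where
  optimal : ∀ C : Computer, ∃ sim : ℕ, ∀ p s, s ∈ C.f p →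
    ∃ p', s ∈ toComputer.f p' ∧ p'.length ≤ p.length + sim

/-- Prefix-free Kolmogorov complexity (program-size complexity) w.r.t. `U`. -/
noncomputable def Kc (U : OptimalComputer) (s : Str) : ℕ :=
  sInf {n | ∃ p : Str, p.length = n ∧ s ∈ U.f p}

/-- A semi-measure on binary strings: values in [0,1] with all finite partial sums ≤ 1. -/
def SemiMeasure (r : Str → ℝ) : Prop :=
  (∀ s, 0 ≤ r s ∧ r s ≤ 1) ∧ ∀ F : Finset Str, ∑ s ∈ F, r s ≤ 1

/-- Lower-computability: approximability from below by a total recursive rational function. -/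
def LowerComputable (r : Str → ℝ) : Prop :=
  ∃ f : ℕ → Str → ℚ, Computable₂ f ∧
    ∀ s : Str, (∀ n : ℕ, 0 ≤ f n s ∧ (f n s : ℝ) ≤ r s) ∧
      Tendsto (fun n => (f n s : ℝ)) atTop (nhds (r s))

/-- A lower-computable semi-measure. -/
def LCSemiMeasure (r : Str → ℝ) : Prop := SemiMeasure r ∧ LowerComputable r

/-- A universal probability: a lower-computable semi-measure dominating all
lower-computable semi-measures up to a positive multiplicative constant. -/
def UniversalProb (m : Str → ℝ) : Prop :=
  LCSemiMeasure m ∧ ∀ r : Str → ℝ, LCSemiMeasure r → ∃ c : ℝ, 0 < c ∧ ∀ s, c * r s ≤ m s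

/-- The first `n` bits of the base-two expansion of `T mod 1`
(the expansion with infinitely many zeros). -/
noncomputable def binPrefix (T : ℝ) (n : ℕ) : Str :=
  (List.range n).map (fun i => decide (⌊Int.fract T * 2 ^ (i + 1)⌋ % 2 = 1))

/-- A real is right-computable if it is the limit from above of a recursive
sequence of rationals. -/
def RightComputableReal (T : ℝ) : Prop :=
  ∃ g : ℕ → ℚ, Computable g ∧ (∀ n, T ≤ (g n : ℝ)) ∧
    Tendsto (fun n => (g n : ℝ)) atTop (nhds T)

/-- A real is left-computable if its negation is right-computable. -/
def LeftComputableReal (T : ℝ) : Prop := RightComputableReal (-T)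

/-- A computable real number. -/
def ComputableReal (T : ℝ) : Prop :=
  ∃ f : ℕ → ℚ, Computable f ∧ ∀ n : ℕ, |T - (f n : ℝ)| < (2 : ℝ)⁻¹ ^ n

/-- A recursively enumerable set of binary strings. -/
def REset (A : Set Str) : Prop :=
  ∃ g : Str →. Unit, Partrec g ∧ ∀ s, (g s).Dom ↔ s ∈ A

/-- `T` is weakly Chaitin `D`-random. -/
noncomputable def WeaklyChaitinDRandom (U : OptimalComputer) (D T : ℝ) : Prop :=
  ∃ c : ℕ, ∀ n : ℕ, D * n - c ≤ Kc U (binPrefix T n)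

/-- `T` is `D`-compressible. -/
noncomputable def DCompressible (U : OptimalComputer) (D T : ℝ) : Prop :=
  Filter.atTop.limsup (fun n : ℕ => (Kc U (binPrefix T n) : ℝ) / n) ≤ D



/-! ### Part 1: computability of the basic operations on rationals -/

/-- The structural code of a rational number. -/
def ratCode (q : ℚ) : ℕ := Nat.pair (Equiv.intEquivNat q.num) q.den

/-- Numbers which are structural codes of rational numbers. -/
def IsRatCode (y : ℕ) : Prop :=
  0 < y.unpair.2 ∧ Nat.Coprime (Equiv.intEquivNat.symm y.unpair.1).natAbs y.unpair.2

instance : DecidablePred IsRatCode := fun y => by unfold IsRatCode; infer_instance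

theorem ratCode_eq (q : ℚ) : ratCode q = @Encodable.encode ℚ Rat.instEncodable q := rfl

theorem isRatCode_iff (y : ℕ) : IsRatCode y ↔ y ∈ Set.range ratCode := by
  constructor
  · rintro ⟨h1, h2⟩
    refine ⟨⟨Equiv.intEquivNat.symm y.unpair.1, y.unpair.2, h1.ne', h2⟩, ?_⟩
    simp [ratCode]
  · rintro ⟨q, rfl⟩
    simp only [IsRatCode, ratCode, Nat.unpair_pair, Equiv.symm_apply_apply]
    exact ⟨q.pos, q.reduced⟩

theorem natAbs_intEquivNat_symm (a : ℕ) :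
    (Equiv.intEquivNat.symm a).natAbs = (a + 1) / 2 := by
  obtain ⟨z, rfl⟩ := Equiv.intEquivNat.surjective a
  rw [Equiv.symm_apply_apply]
  rcases z with n | n
  · have : Equiv.intEquivNat (Int.ofNat n) = 2 * n := rfl
    rw [this]; simp only [Int.ofNat_eq_natCast, Int.natAbs_natCast]; omega
  · have : Equiv.intEquivNat (Int.negSucc n) = 2 * n + 1 := rfl
    rw [this]; simp only [Int.natAbs_negSucc]; omega

theorem intEquivNat_toNat (z : ℤ) :
    z.toNat = if (Equiv.intEquivNat z) % 2 = 0 then (Equiv.intEquivNat z) / 2 else 0 := by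
  rcases z with n | n
  · have : Equiv.intEquivNat (Int.ofNat n) = 2 * n := rfl
    rw [this]; simp
  · have : Equiv.intEquivNat (Int.negSucc n) = 2 * n + 1 := rfl
    rw [this, if_neg (by omega)]; rfl

theorem intEquivNat_nonneg (z : ℤ) :
    0 ≤ z ↔ (Equiv.intEquivNat z) % 2 = 0 := by
  rcases z with n | n
  · have : Equiv.intEquivNat (Int.ofNat n) = 2 * n := rfl
    rw [this]; simp
  · have : Equiv.intEquivNat (Int.negSucc n) = 2 * n + 1 := rfl
    rw [this]
    constructor
    · intro h; exact absurd h (by simp)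
    · intro h; omega

theorem coprime_iff_bdd (a b : ℕ) (hb : 0 < b) :
    Nat.Coprime a b ↔ ∀ d < b + 1, ¬ (a % d = 0 ∧ b % d = 0 ∧ 1 < d) := by
  constructor
  · rintro h d - ⟨h1, h2, h3⟩
    have := Nat.dvd_gcd (Nat.dvd_of_mod_eq_zero h1) (Nat.dvd_of_mod_eq_zero h2)
    rw [h.gcd_eq_one] at this
    have := Nat.le_of_dvd one_pos this
    omega
  · intro h
    by_contra hc
    have h1 := Nat.gcd_dvd_left a b
    have h2 := Nat.gcd_dvd_right a b
    have h3 : Nat.gcd a b ≠ 0 := by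
      rw [Ne, Nat.gcd_eq_zero_iff]; omega
    refine h (Nat.gcd a b) (by have := Nat.le_of_dvd hb h2; omega)
      ⟨Nat.mod_eq_zero_of_dvd h1, Nat.mod_eq_zero_of_dvd h2, ?_⟩
    have : Nat.gcd a b ≠ 1 := hc
    omega

theorem primrec_isRatCode : PrimrecPred IsRatCode := by
  have hR : PrimrecRel (fun (d : ℕ) (p : ℕ × ℕ) => ¬ (p.1 % d = 0 ∧ p.2 % d = 0 ∧ 1 < d)) := by
    refine PrimrecPred.not (PrimrecPred.and ?_ (PrimrecPred.and ?_ ?_))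
    · exact Primrec.eq.comp (Primrec.nat_mod.comp (Primrec.fst.comp Primrec.snd) Primrec.fst)
        (Primrec.const 0)
    · exact Primrec.eq.comp (Primrec.nat_mod.comp (Primrec.snd.comp Primrec.snd) Primrec.fst)
        (Primrec.const 0)
    · exact Primrec.nat_lt.comp (Primrec.const 1) Primrec.fst
  have h2 : Primrec (fun y : ℕ => y.unpair.2) := Primrec.snd.comp Primrec.unpair
  have h1 : Primrec (fun y : ℕ => (y.unpair.1 + 1) / 2) :=
    Primrec.nat_div.comp (Primrec.succ.comp (Primrec.fst.comp Primrec.unpair)) (Primrec.const 2)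
  have h3 := (PrimrecRel.forall_mem_list hR).comp
    (Primrec.list_range.comp (Primrec.succ.comp h2)) (h1.pair h2)
  have h4 : PrimrecPred (fun y : ℕ => 0 < y.unpair.2) :=
    Primrec.nat_lt.comp (Primrec.const 0) h2
  refine (h4.and h3).of_eq ?_
  intro y
  unfold IsRatCode
  rw [natAbs_intEquivNat_symm]
  constructor
  · rintro ⟨a, b⟩
    exact ⟨a, (coprime_iff_bdd _ _ a).2 (fun d hd => b d (List.mem_range.2 hd))⟩
  · rintro ⟨a, b⟩
    exact ⟨a, fun d hd => (coprime_iff_bdd _ _ a).1 b d (List.mem_range.1 hd)⟩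

/-- The index of a rational number in the enumeration underlying `Primcodable ℚ`. -/
def ratIdx (q : ℚ) : ℕ := @Encodable.encode ℚ Primcodable.toEncodable q

theorem ratIdx_inj {q q' : ℚ} : ratIdx q = ratIdx q' ↔ q = q' :=
  @Encodable.encode_inj ℚ Primcodable.toEncodable q q'

theorem ofNat_ratIdx (q : ℚ) : Denumerable.ofNat ℚ (ratIdx q) = q :=
  @Denumerable.ofNat_encode ℚ Rat.instDenumerable q

theorem ratIdx_ofNat (n : ℕ) : ratIdx (Denumerable.ofNat ℚ n) = n :=
  @Denumerable.encode_ofNat ℚ Rat.instDenumerable n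

theorem primrec_ratIdx : Primrec ratIdx := Primrec.encode

theorem encode_rat (q : ℚ) :
    ratIdx q = (List.range (ratCode q)).countP (fun y => decide (IsRatCode y)) := by
  have : ratIdx q = (List.range (ratCode q)).countP
    (fun y => @decide (y ∈ Set.range (@Encodable.encode ℚ Rat.instEncodable))
      (@Encodable.decidableRangeEncode ℚ _ y)) := rfl
  rw [this]
  apply List.countP_congr
  intro y _
  simp only [decide_eq_true_eq]
  rw [isRatCode_iff]; rfl

theorem computable_ratCode : Computable ratCode := by
  have hc : Primrec (fun k : ℕ => (List.range k).countP (fun y => decide (IsRatCode y))) := by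
    have := Primrec.list_length.comp ((Primrec.listFilter primrec_isRatCode).comp Primrec.list_range)
    exact this.of_eq (fun k => by rw [List.countP_eq_length_filter])
  have hp : PrimrecRel (fun (q : ℚ) (y : ℕ) => IsRatCode y ∧
      (List.range y).countP (fun y => decide (IsRatCode y)) = ratIdx q) := by
    refine PrimrecPred.and (primrec_isRatCode.comp Primrec.snd) ?_
    exact Primrec.eq.comp (hc.comp Primrec.snd) (primrec_ratIdx.comp Primrec.fst)
  have hd := hp.decide
  have := Partrec.rfind hd.to_comp.partrec₂
  refine Partrec.of_eq_tot this ?_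
  intro q
  rw [Nat.mem_rfind]
  constructor
  · simp only [PFun.coe_val, Part.mem_some_iff, eq_comm (a := true), decide_eq_true_eq]
    refine ⟨(isRatCode_iff _).2 ⟨q, rfl⟩, (encode_rat q).symm⟩
  · intro m hm
    simp only [PFun.coe_val, Part.mem_some_iff, eq_comm (a := false), decide_eq_false_iff_not]
    rintro ⟨h1, h2⟩
    obtain ⟨q', rfl⟩ := (isRatCode_iff m).1 h1
    rw [← encode_rat, ratIdx_inj] at h2
    subst h2
    exact lt_irrefl _ hm

theorem computable_num : Computable (fun q : ℚ => q.num.toNat) := by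
  have h : Primrec (fun y : ℕ => if y.unpair.1 % 2 = 0 then y.unpair.1 / 2 else 0) := by
    have h1 : Primrec (fun y : ℕ => y.unpair.1) := Primrec.fst.comp Primrec.unpair
    exact Primrec.ite (Primrec.eq.comp (Primrec.nat_mod.comp h1 (Primrec.const 2)) (Primrec.const 0))
      (Primrec.nat_div.comp h1 (Primrec.const 2)) (Primrec.const 0)
  refine (h.to_comp.comp computable_ratCode).of_eq (fun q => ?_)
  simp only [ratCode, Nat.unpair_pair]
  rw [intEquivNat_toNat]

theorem computable_den : Computable (fun q : ℚ => q.den) := by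
  have h1 : Primrec (fun y : ℕ => y.unpair.2) := Primrec.snd.comp Primrec.unpair
  refine (h1.to_comp.comp computable_ratCode).of_eq (fun q => ?_)
  simp only [ratCode, Nat.unpair_pair]

theorem computable_isNonneg : Computable (fun q : ℚ => decide (0 ≤ q)) := by
  have h1 : PrimrecPred (fun y : ℕ => y.unpair.1 % 2 = 0) :=
    Primrec.eq.comp (Primrec.nat_mod.comp (Primrec.fst.comp Primrec.unpair) (Primrec.const 2))
      (Primrec.const 0)
  refine (h1.decide.to_comp.comp computable_ratCode).of_eq (fun q => ?_)
  simp only [ratCode, Nat.unpair_pair]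
  congr 1
  rw [← intEquivNat_nonneg, Rat.num_nonneg]

theorem computable_mkRat : Computable (fun p : ℕ × ℕ => (p.1 : ℚ) / ((p.2 + 1 : ℕ) : ℚ)) := by
  have hN : Computable (fun n : ℕ => Denumerable.ofNat ℚ n) := Computable.ofNat ℚ
  have hs : Computable₂ (fun (p : ℕ × ℕ) (n : ℕ) =>
      (decide (0 ≤ Denumerable.ofNat ℚ n) &&
        decide ((Denumerable.ofNat ℚ n).num.toNat * (p.2 + 1) = p.1 * (Denumerable.ofNat ℚ n).den))) := by
    have hprim : PrimrecPred (fun t : (ℕ × ℕ) × (ℕ × ℕ) => t.2.1 * (t.1.2 + 1) = t.1.1 * t.2.2) :=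
      Primrec.eq.comp
        (Primrec.nat_mul.comp (Primrec.fst.comp Primrec.snd)
          (Primrec.succ.comp (Primrec.snd.comp Primrec.fst)))
        (Primrec.nat_mul.comp (Primrec.fst.comp Primrec.fst) (Primrec.snd.comp Primrec.snd))
    have e1 : Computable (fun t : (ℕ × ℕ) × ℕ => Denumerable.ofNat ℚ t.2) := hN.comp Computable.snd
    have e2 := hprim.decide.to_comp.comp
      (Computable.fst.pair ((computable_num.comp e1).pair (computable_den.comp e1)))
    exact (Primrec.and.to_comp.comp (computable_isNonneg.comp e1) e2)
  have hr := Partrec.rfind hs.partrec₂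
  have := hr.map (hN.comp Computable.snd).to₂
  refine Partrec.of_eq_tot this ?_
  intro p
  simp only [Part.mem_map_iff]
  refine ⟨ratIdx ((p.1 : ℚ) / ((p.2 + 1 : ℕ) : ℚ)), ?_, ofNat_ratIdx _⟩
  have key : ∀ q : ℚ, (0 ≤ q ∧ q.num.toNat * (p.2 + 1) = p.1 * q.den) ↔
      q = (p.1 : ℚ) / ((p.2 + 1 : ℕ) : ℚ) := by
    intro q
    have hd : (q.den : ℚ) ≠ 0 := by exact_mod_cast q.den_nz
    have hp : ((p.2 + 1 : ℕ) : ℚ) ≠ 0 := by positivity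
    have aux : 0 ≤ q → (q.num.toNat * (p.2 + 1) = p.1 * q.den ↔
      q = (p.1 : ℚ) / ((p.2 + 1 : ℕ) : ℚ)) := by
      intro h0
      have hn : ((q.num.toNat : ℕ) : ℚ) = q * q.den := by
        rw [Rat.mul_den_eq_num]
        have := Int.toNat_of_nonneg (Rat.num_nonneg.2 h0)
        exact_mod_cast this
      rw [eq_div_iff hp]
      rw [← Nat.cast_inj (R := ℚ)]
      push_cast
      rw [hn]
      constructor
      · intro h
        apply mul_right_cancel₀ hd
        linarith
      · intro h
        rw [← h]; ring
    constructor
    · rintro ⟨h0, h1⟩; exact (aux h0).1 h1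
    · intro h
      have h0 : 0 ≤ q := by rw [h]; positivity
      exact ⟨h0, (aux h0).2 h⟩
  rw [Nat.mem_rfind]
  constructor
  · simp only [PFun.coe_val, Part.mem_some_iff, ofNat_ratIdx]
    symm
    rw [Bool.and_eq_true, decide_eq_true_eq, decide_eq_true_eq]
    exact (key _).2 rfl
  · intro m hm
    simp only [PFun.coe_val, Part.mem_some_iff]
    symm
    rw [Bool.eq_false_iff]
    intro h
    rw [Bool.and_eq_true, decide_eq_true_eq, decide_eq_true_eq] at h
    have := (key _).1 h
    rw [← this, ratIdx_ofNat] at hm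
    exact lt_irrefl _ hm

theorem primrec_pow : Primrec₂ (fun a n : ℕ => a ^ n) := by
  have : Primrec₂ (fun (a n : ℕ) => Nat.rec (motive := fun _ => ℕ) 1 (fun _ r => r * a) n) :=
    Primrec.nat_rec (f := fun _ : ℕ => 1) (Primrec.const 1)
      (Primrec.nat_mul.comp (Primrec.snd.comp Primrec.snd) Primrec.fst).to₂
  refine this.of_eq ?_
  intro a n
  induction n with
  | zero => simp
  | succ n ih => simp only [pow_succ, ← ih]


/-! ### Part 2: a universal lower-computable semimeasure on the natural numbers -/

open Nat.Partrec (Code) in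
/-- New information about the value at `i` found at stage `t`, scaled by `2 ^ (t + 1)`. -/
def newv (c : Code) (t i : ℕ) : ℕ :=
  ((Code.evaln t.unpair.2 c (Nat.pair t.unpair.1 i)).getD 0) * 2 ^ (t + 1 - t.unpair.1)

/-- Doubled old state. -/
def oldL (t : ℕ) (L : List ℕ) : List ℕ :=
  (List.range (t + 1)).map (fun i => 2 * L.getD i 0)

/-- Candidate new state. -/
def candL (c : Nat.Partrec.Code) (t : ℕ) (L : List ℕ) : List ℕ :=
  (List.range (t + 1)).map (fun i => max (2 * L.getD i 0) (newv c t i))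

/-- The greedy update, which rejects updates that violate the semimeasure inequality. -/
def stepL (c : Nat.Partrec.Code) (t : ℕ) (L : List ℕ) : List ℕ :=
  if (candL c t L).sum ≤ 2 ^ (t + 1) then candL c t L else oldL t L

/-- The state at stage `t`. -/
def stL (c : Nat.Partrec.Code) : ℕ → List ℕ
  | 0 => []
  | t + 1 => stepL c t (stL c t)

theorem primrec_sum : Primrec (fun L : List ℕ => L.sum) := by
  have := Primrec.list_foldr (f := fun L : List ℕ => L) (g := fun _ => 0)
    (h := fun (_ : List ℕ) (p : ℕ × ℕ) => p.1 + p.2) Primrec.id (Primrec.const 0)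
    (Primrec.nat_add.comp (Primrec.fst.comp Primrec.snd) (Primrec.snd.comp Primrec.snd)).to₂
  exact this.of_eq (fun L => by rw [List.sum_eq_foldr])

theorem primrec_newv :
    Primrec (fun p : (Nat.Partrec.Code × ℕ) × ℕ => newv p.1.1 p.1.2 p.2) := by
  have hu : Primrec (fun p : (Nat.Partrec.Code × ℕ) × ℕ => p.1.2.unpair) :=
    Primrec.unpair.comp (Primrec.snd.comp Primrec.fst)
  have he := Nat.Partrec.Code.primrec_evaln.comp
    (((Primrec.snd.comp hu).pair (Primrec.fst.comp (Primrec.fst (α := Nat.Partrec.Code × ℕ) (β := ℕ)))).pair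
      (Primrec₂.natPair.comp (Primrec.fst.comp hu) Primrec.snd))
  have hg := Primrec.option_getD.comp he (Primrec.const 0)
  have hp := primrec_pow.comp (Primrec.const 2)
    (Primrec.nat_sub.comp (Primrec.succ.comp (Primrec.snd.comp (Primrec.fst (α := Nat.Partrec.Code × ℕ) (β := ℕ))))
      (Primrec.fst.comp hu))
  exact Primrec.nat_mul.comp hg hp

theorem primrec_oldL : Primrec (fun p : ℕ × List ℕ => oldL p.1 p.2) := by
  refine Primrec.list_map (Primrec.list_range.comp (Primrec.succ.comp Primrec.fst)) ?_
  exact (Primrec.nat_mul.comp (Primrec.const 2)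
    ((Primrec.list_getD 0).comp (Primrec.snd.comp Primrec.fst) Primrec.snd)).to₂

theorem primrec_candL :
    Primrec (fun p : (Nat.Partrec.Code × ℕ) × List ℕ => candL p.1.1 p.1.2 p.2) := by
  refine Primrec.list_map
    (Primrec.list_range.comp (Primrec.succ.comp (Primrec.snd.comp Primrec.fst))) ?_
  exact (Primrec.nat_max.comp (Primrec.nat_mul.comp (Primrec.const 2)
    ((Primrec.list_getD 0).comp (Primrec.snd.comp Primrec.fst) Primrec.snd))
    (primrec_newv.comp ((Primrec.fst.comp Primrec.fst).pair Primrec.snd))).to₂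

theorem primrec_stL : Primrec₂ stL := by
  have hs : Primrec (fun p : Nat.Partrec.Code × (ℕ × List ℕ) => stepL p.1 p.2.1 p.2.2) := by
    have hc : Primrec (fun p : Nat.Partrec.Code × (ℕ × List ℕ) => candL p.1 p.2.1 p.2.2) :=
      primrec_candL.comp ((Primrec.fst.pair (Primrec.fst.comp Primrec.snd)).pair
        (Primrec.snd.comp Primrec.snd))
    refine Primrec.ite (Primrec.nat_le.comp (primrec_sum.comp hc)
      (primrec_pow.comp (Primrec.const 2) (Primrec.succ.comp (Primrec.fst.comp Primrec.snd)))) hc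
      (primrec_oldL.comp Primrec.snd)
  have := Primrec.nat_rec (f := fun _ : Nat.Partrec.Code => ([] : List ℕ)) (Primrec.const [])
    (g := fun c p => stepL c p.1 p.2) hs.to₂
  refine this.of_eq ?_
  intro c t
  induction t with
  | zero => rfl
  | succ t ih => simp only [stL, ← ih]

theorem getD_map_range (f : ℕ → ℕ) (k i : ℕ) :
    ((List.range k).map f).getD i 0 = if i < k then f i else 0 := by
  split_ifs with h
  · rw [List.getD_eq_getElem?_getD]; simp [h]
  · rw [List.getD_eq_getElem?_getD]; simp [h]

theorem sum_map_range (f : ℕ → ℕ) (k : ℕ) :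
    ((List.range k).map f).sum = ∑ i ∈ Finset.range k, f i := by
  induction k with
  | zero => simp
  | succ k ih => rw [List.range_succ, Finset.sum_range_succ]; simp [ih]

/-- The value at `i` at stage `t`. -/
def bf (c : Nat.Partrec.Code) (t i : ℕ) : ℕ := (stL c t).getD i 0

theorem bf_zero_of_le (c : Nat.Partrec.Code) (t i : ℕ) (h : t ≤ i) : bf c t i = 0 := by
  cases t with
  | zero => simp [bf, stL]
  | succ t =>
    simp only [bf, stL, stepL]
    split_ifs
    · rw [candL, getD_map_range, if_neg (by omega)]
    · rw [oldL, getD_map_range, if_neg (by omega)]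

theorem bf_succ_old (c : Nat.Partrec.Code) (t i : ℕ)
    (h : ¬ (candL c t (stL c t)).sum ≤ 2 ^ (t + 1)) : bf c (t + 1) i = 2 * bf c t i := by
  conv_lhs => simp only [bf, stL, stepL]
  rw [if_neg h, oldL, getD_map_range]
  split_ifs with h'
  · rfl
  · rw [bf_zero_of_le _ _ _ (by omega)]

theorem bf_succ_cand (c : Nat.Partrec.Code) (t i : ℕ)
    (h : (candL c t (stL c t)).sum ≤ 2 ^ (t + 1)) :
    bf c (t + 1) i = if i < t + 1 then max (2 * bf c t i) (newv c t i) else 0 := by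
  conv_lhs => simp only [bf, stL, stepL]
  rw [if_pos h, candL, getD_map_range]
  rfl

theorem bf_mono (c : Nat.Partrec.Code) (t i : ℕ) : 2 * bf c t i ≤ bf c (t + 1) i := by
  by_cases h : (candL c t (stL c t)).sum ≤ 2 ^ (t + 1)
  · rw [bf_succ_cand _ _ _ h]
    split_ifs with h'
    · exact le_max_left _ _
    · rw [bf_zero_of_le _ _ _ (by omega)]
  · rw [bf_succ_old _ _ _ h]

theorem bf_sum (c : Nat.Partrec.Code) (t : ℕ) : ∑ i ∈ Finset.range t, bf c t i ≤ 2 ^ t := by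
  induction t with
  | zero => simp
  | succ t ih =>
    by_cases h : (candL c t (stL c t)).sum ≤ 2 ^ (t + 1)
    · refine le_trans (le_of_eq ?_) h
      rw [candL, sum_map_range]
      refine Finset.sum_congr rfl (fun i hi => ?_)
      rw [bf_succ_cand _ _ _ h, if_pos (Finset.mem_range.1 hi)]
      rfl
    · rw [Finset.sum_congr rfl (fun i _ => bf_succ_old c t i h), Finset.sum_range_succ,
        bf_zero_of_le _ _ _ le_rfl, ← Finset.mul_sum, pow_succ]
      omega

theorem bf_sum' (c : Nat.Partrec.Code) (t N : ℕ) : ∑ i ∈ Finset.range N, bf c t i ≤ 2 ^ t := by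
  refine le_trans ?_ (bf_sum c t)
  rcases le_total N t with h | h
  · exact Finset.sum_le_sum_of_subset (Finset.range_mono h)
  · refine le_of_eq (Finset.sum_subset (Finset.range_mono h) ?_).symm
    intro i _ hi
    exact bf_zero_of_le _ _ _ (by simpa using hi)

/-- Stage approximations of the universal mixture, scaled by `4 ^ t`. -/
def am (t i : ℕ) : ℕ :=
  ∑ e ∈ Finset.range t, 2 ^ (t - e - 1) * bf (Denumerable.ofNat Nat.Partrec.Code e) t i

theorem primrec_am : Primrec₂ am := by
  have h1 : Primrec₂ (fun (p : ℕ × ℕ) (e : ℕ) =>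
      2 ^ (p.1 - e - 1) * bf (Denumerable.ofNat Nat.Partrec.Code e) p.1 p.2) := by
    have hf : Primrec (fun x : (ℕ × ℕ) × ℕ => x.1.1) := Primrec.fst.comp Primrec.fst
    have hs : Primrec (fun x : (ℕ × ℕ) × ℕ => x.1.2) := Primrec.snd.comp Primrec.fst
    refine Primrec.nat_mul.comp (primrec_pow.comp (Primrec.const 2)
      (Primrec.nat_sub.comp (Primrec.nat_sub.comp hf Primrec.snd) (Primrec.const 1))) ?_
    exact (Primrec.list_getD 0).comp
      (primrec_stL.comp ((Primrec.ofNat Nat.Partrec.Code).comp Primrec.snd) hf) hs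
  have h2 := primrec_sum.comp (Primrec.list_map (Primrec.list_range.comp Primrec.fst) h1)
  exact h2.of_eq (fun p => by rw [sum_map_range]; rfl)

theorem am_mono (t i : ℕ) : 4 * am t i ≤ am (t + 1) i := by
  unfold am
  rw [Finset.sum_range_succ, Finset.mul_sum]
  refine le_trans (Finset.sum_le_sum ?_) (Nat.le_add_right _ _)
  intro e he
  have he' := Finset.mem_range.1 he
  have h1 : t + 1 - e - 1 = (t - e - 1) + 1 := by omega
  have h2 := bf_mono (Denumerable.ofNat Nat.Partrec.Code e) t i
  rw [h1, pow_succ]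
  calc 4 * (2 ^ (t - e - 1) * bf (Denumerable.ofNat Nat.Partrec.Code e) t i)
      = 2 ^ (t - e - 1) * 2 * (2 * bf (Denumerable.ofNat Nat.Partrec.Code e) t i) := by ring
    _ ≤ _ := Nat.mul_le_mul_left _ h2

theorem am_sum (t N : ℕ) : ∑ i ∈ Finset.range N, am t i ≤ 4 ^ t := by
  unfold am
  rw [Finset.sum_comm]
  calc ∑ e ∈ Finset.range t, ∑ i ∈ Finset.range N,
        2 ^ (t - e - 1) * bf (Denumerable.ofNat Nat.Partrec.Code e) t i
      ≤ ∑ e ∈ Finset.range t, 2 ^ (t - 1 - e) * 2 ^ t := by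
        refine Finset.sum_le_sum (fun e _ => ?_)
        rw [← Finset.mul_sum, show t - 1 - e = t - e - 1 by omega]
        exact Nat.mul_le_mul_left _ (bf_sum' _ _ _)
    _ = (∑ e ∈ Finset.range t, 2 ^ e) * 2 ^ t := by
        rw [← Finset.sum_mul, Finset.sum_range_reflect (fun e => 2 ^ e)]
    _ ≤ 2 ^ t * 2 ^ t := Nat.mul_le_mul_right _ (by
        have := Nat.geomSum_lt (m := 2) (n := t) (s := Finset.range t) le_rfl
          (fun k hk => Finset.mem_range.1 hk)
        exact this.le)
    _ = 4 ^ t := by rw [← mul_pow]; norm_num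

theorem am_dominates (r : ℕ → ℝ) (hr0 : ∀ i, 0 ≤ r i)
    (hr1 : ∀ F : Finset ℕ, ∑ i ∈ F, r i ≤ 1) (φ : ℕ → ℕ → ℕ) (hφ : Computable₂ φ)
    (hle : ∀ n i, (φ n i : ℝ) / 2 ^ n ≤ r i) :
    ∃ e : ℕ, ∀ n i, ∃ t, φ n i * 4 ^ t ≤ am t i * 2 ^ (n + e + 1) := by
  have hcomp : Computable (fun x : ℕ => φ x.unpair.1 x.unpair.2) :=
    hφ.comp (Computable.fst.comp Computable.unpair) (Computable.snd.comp Computable.unpair)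
  obtain ⟨c, hc⟩ := Nat.Partrec.Code.exists_code.1 (Partrec.nat_iff.1 hcomp.partrec)
  have hval : ∀ k n i v, v ∈ Nat.Partrec.Code.evaln k c (Nat.pair n i) → v = φ n i := by
    intro k n i v hv
    have := Nat.Partrec.Code.evaln_sound hv
    rw [hc] at this
    simpa using this
  have hnew : ∀ t i, (newv c t i : ℝ) / 2 ^ (t + 1) ≤ r i := by
    intro t i
    unfold newv
    rcases h : Nat.Partrec.Code.evaln t.unpair.2 c (Nat.pair t.unpair.1 i) with _ | v
    · simpa using hr0 i
    · have hv := hval _ _ _ v h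
      have hn := Nat.unpair_left_le t
      refine le_trans (le_of_eq ?_) (hle t.unpair.1 i)
      rw [← hv]
      obtain ⟨d, hd⟩ : ∃ d, t + 1 = t.unpair.1 + d := ⟨t + 1 - t.unpair.1, by omega⟩
      have : t + 1 - t.unpair.1 = d := by omega
      rw [this, hd, pow_add]
      push_cast
      simp only [Option.getD_some]
      field_simp
  have hbf : ∀ t i, (bf c t i : ℝ) / 2 ^ t ≤ r i := by
    intro t
    induction t with
    | zero => intro i; simpa [bf, stL] using hr0 i
    | succ t ih =>
      intro i
      have h2 : ((2 * bf c t i : ℕ) : ℝ) / 2 ^ (t + 1) ≤ r i := by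
        refine le_trans (le_of_eq ?_) (ih i)
        push_cast; rw [pow_succ]; field_simp
      by_cases h : (candL c t (stL c t)).sum ≤ 2 ^ (t + 1)
      · rw [bf_succ_cand _ _ _ h]
        split_ifs with h'
        · rcases max_choice (2 * bf c t i) (newv c t i) with h3 | h3
          · rw [h3]; exact h2
          · rw [h3]; exact hnew t i
        · simpa using hr0 i
      · rw [bf_succ_old _ _ _ h]; exact h2
  have hacc : ∀ t, (candL c t (stL c t)).sum ≤ 2 ^ (t + 1) := by
    intro t
    rw [candL, sum_map_range]
    have : ((∑ i ∈ Finset.range (t + 1), max (2 * (stL c t).getD i 0) (newv c t i) : ℕ) : ℝ)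
        / 2 ^ (t + 1) ≤ 1 := by
      rw [Nat.cast_sum, Finset.sum_div]
      refine le_trans (Finset.sum_le_sum (fun i _ => ?_)) (hr1 (Finset.range (t + 1)))
      rcases max_choice (2 * (stL c t).getD i 0) (newv c t i) with h3 | h3
      · rw [h3]
        refine le_trans (le_of_eq ?_) (hbf t i)
        unfold bf
        push_cast; rw [pow_succ]; field_simp
      · rw [h3]; exact hnew t i
    rw [div_le_one (by positivity)] at this
    exact_mod_cast this
  refine ⟨Encodable.encode c, fun n i => ?_⟩
  obtain ⟨k, hk⟩ : ∃ k, φ n i ∈ Nat.Partrec.Code.evaln k c (Nat.pair n i) := by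
    apply Nat.Partrec.Code.evaln_complete.1
    rw [hc]; simp
  set K := k + i + Encodable.encode c with hK
  have hk' : φ n i ∈ Nat.Partrec.Code.evaln K c (Nat.pair n i) :=
    Nat.Partrec.Code.evaln_mono (by omega) hk
  set t := Nat.pair n K with ht
  have hKt : K ≤ t := Nat.right_le_pair n K
  have hnt : n ≤ t := Nat.left_le_pair n K
  have hb : φ n i * 2 ^ (t + 1 - n) ≤ bf c (t + 1) i := by
    rw [bf_succ_cand _ _ _ (hacc t), if_pos (by omega)]
    refine le_trans ?_ (le_max_right _ _)
    unfold newv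
    rw [ht, Nat.unpair_pair]
    simp only
    rw [Option.mem_def.1 hk']
    simp
  refine ⟨t + 1, ?_⟩
  have ha : 2 ^ (t + 1 - Encodable.encode c - 1) * bf c (t + 1) i ≤ am (t + 1) i := by
    have := Finset.single_le_sum (s := Finset.range (t + 1))
      (f := fun e => 2 ^ (t + 1 - e - 1) * bf (Denumerable.ofNat Nat.Partrec.Code e) (t + 1) i)
      (fun _ _ => Nat.zero_le _) (Finset.mem_range.2 (show Encodable.encode c < t + 1 by omega))
    simp only [Denumerable.ofNat_encode] at this
    exact this
  calc φ n i * 4 ^ (t + 1) = φ n i * (2 ^ (t + 1) * 2 ^ (t + 1)) := by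
        rw [← mul_pow]; norm_num
    _ = φ n i * 2 ^ (t + 1 - n) * (2 ^ (t + 1 - Encodable.encode c - 1)
          * 2 ^ (n + Encodable.encode c + 1)) := by
        rw [mul_assoc, ← pow_add, ← pow_add, ← pow_add]
        congr 2
        omega
    _ ≤ bf c (t + 1) i * (2 ^ (t + 1 - Encodable.encode c - 1)
          * 2 ^ (n + Encodable.encode c + 1)) := Nat.mul_le_mul_right _ hb
    _ = (2 ^ (t + 1 - Encodable.encode c - 1) * bf c (t + 1) i)
          * 2 ^ (n + Encodable.encode c + 1) := by ring
    _ ≤ _ := Nat.mul_le_mul_right _ ha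


/-! ### Part 3: the halting probability and the stage approximations -/

open Nat.Partrec (Code)

/-- `c` is a code for the computer `C`. -/
def IsCodeOf (c : Code) (C : Computer) : Prop :=
  ∀ (p : Str) (v : ℕ), v ∈ Code.eval c (Encodable.encode p) ↔ ∃ s ∈ C.f p, Encodable.encode s = v

theorem exists_isCodeOf (C : Computer) : ∃ c, IsCodeOf c C := by
  obtain ⟨c, hc⟩ := Code.exists_code.1 C.partrec
  refine ⟨c, fun p v => ?_⟩
  rw [hc]
  simp

/-- Weight of the program with code `i` at stage `t`, scaled by `2 ^ t`. -/
def wt (c : Code) (t i : ℕ) : ℕ :=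
  ((Encodable.decode₂ Str i).map
    (fun p => if (Code.evaln t c i).isSome = true then 2 ^ (t - p.length) else 0)).getD 0

/-- Stage approximation of the halting probability, scaled by `2 ^ t`. -/
def wsum (c : Code) (t : ℕ) : ℕ := ∑ i ∈ Finset.range t, wt c t i

theorem primrec_wsum (c : Code) : Primrec (wsum c) := by
  have he : Primrec (fun x : (ℕ × ℕ) => (Code.evaln x.1 c x.2)) :=
    Code.primrec_evaln.comp ((Primrec.fst.pair (Primrec.const c)).pair Primrec.snd)
  have h1 : Primrec₂ (fun (t : ℕ) (i : ℕ) => wt c t i) := by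
    refine Primrec.option_getD.comp (Primrec.option_map (Primrec.decode₂.comp Primrec.snd) ?_)
      (Primrec.const 0)
    refine Primrec.ite (Primrec.eq.comp (Primrec.option_isSome.comp (he.comp Primrec.fst))
      (Primrec.const true)) ?_ (Primrec.const 0)
    exact primrec_pow.comp (Primrec.const 2) (Primrec.nat_sub.comp (Primrec.fst.comp Primrec.fst)
      (Primrec.list_length.comp Primrec.snd))
  have h2 := primrec_sum.comp (Primrec.list_map (f := fun t : ℕ => List.range t)
    Primrec.list_range h1)
  exact h2.of_eq (fun t => by rw [sum_map_range]; rfl)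

/-- The programs that have been seen to halt at stage `t`. -/
noncomputable def haltSet (c : Code) (t : ℕ) : Finset Str :=
  ((Finset.range t).preimage (Encodable.encode : Str → ℕ)
    (Encodable.encode_injective.injOn)).filter
      (fun p => (Code.evaln t c (Encodable.encode p)).isSome = true)

theorem mem_haltSet (c : Code) (t : ℕ) (p : Str) :
    p ∈ haltSet c t ↔ (Code.evaln t c (Encodable.encode p)).isSome = true := by
  simp only [haltSet, Finset.mem_filter, Finset.mem_preimage, Finset.mem_range, and_iff_right_iff_imp]
  intro h
  obtain ⟨x, hx⟩ := Option.isSome_iff_exists.1 h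
  exact Code.evaln_bound (Option.mem_def.2 hx)

theorem haltSet_mono (c : Code) {t t' : ℕ} (h : t ≤ t') : haltSet c t ⊆ haltSet c t' := by
  intro p hp
  rw [mem_haltSet] at hp ⊢
  obtain ⟨x, hx⟩ := Option.isSome_iff_exists.1 hp
  exact Option.isSome_iff_exists.2 ⟨x, Code.evaln_mono h (Option.mem_def.2 hx)⟩

theorem length_le_encode (p : Str) : p.length ≤ Encodable.encode p := by
  exact Encodable.length_le_encode p

theorem wsum_eq (c : Code) (t : ℕ) :
    (wsum c t : ℝ) / 2 ^ t = ∑ p ∈ haltSet c t, (1 / 2 : ℝ) ^ p.length := by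
  have h1 : wsum c t = ∑ p ∈ (Finset.range t).preimage (Encodable.encode : Str → ℕ)
      (Encodable.encode_injective.injOn), wt c t (Encodable.encode p) := by
    symm
    apply Finset.sum_preimage
    intro i _ hi
    have : Encodable.decode₂ Str i = none := by
      by_contra hne
      exact hi (Encodable.decode₂_ne_none_iff.1 hne)
    simp [wt, this]
  rw [h1, haltSet, Finset.sum_filter, Nat.cast_sum, Finset.sum_div]
  refine Finset.sum_congr rfl (fun p hp => ?_)
  have hlt : Encodable.encode p < t := by simpa using hp
  have hl := length_le_encode p
  simp only [wt, Encodable.encodek₂, Option.map_some, Option.getD_some]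
  split_ifs with h
  · obtain ⟨d, hd⟩ : ∃ d, t = p.length + d := ⟨t - p.length, by omega⟩
    have : t - p.length = d := by omega
    rw [this, hd, pow_add]
    push_cast
    rw [one_div, inv_pow]
    field_simp
  · simp

theorem haltSet_dom {C : Computer} {c : Code} (hc : IsCodeOf c C) {t : ℕ} {p : Str}
    (hp : p ∈ haltSet c t) : (C.f p).Dom := by
  rw [mem_haltSet] at hp
  obtain ⟨x, hx⟩ := Option.isSome_iff_exists.1 hp
  have := Code.evaln_sound (Option.mem_def.2 hx)
  obtain ⟨s, hs, -⟩ := (hc p x).1 this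
  exact Part.dom_iff_mem.2 ⟨s, hs⟩

theorem kraft_prefixFree (S : Finset Str)
    (hS : ∀ p ∈ S, ∀ q ∈ S, p <+: q → p = q) :
    ∑ p ∈ S, (1 / 2 : ℝ) ^ p.length ≤ 1 := by
  by_cases hnil : [] ∈ S
  · have : S = {[]} := by
      apply Finset.eq_singleton_iff_unique_mem.2
      exact ⟨hnil, fun q hq => (hS [] hnil q hq (List.nil_prefix)).symm⟩
    rw [this]; simp
  · have hU : InformationTheory.UniquelyDecodable (S : Set Str) := by
      intro L₁
      induction L₁ with
      | nil =>
        intro L₂ _ h2 h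
        cases L₂ with
        | nil => rfl
        | cons a L₂ =>
          exfalso
          simp only [List.flatten_nil, List.flatten_cons] at h
          have ha : a = [] := (List.append_eq_nil_iff.1 h.symm).1
          exact hnil (ha ▸ h2 a (by simp))
      | cons b L₁ ih =>
        intro L₂ h1 h2 h
        cases L₂ with
        | nil =>
          exfalso
          simp only [List.flatten_nil, List.flatten_cons] at h
          have ha : b = [] := (List.append_eq_nil_iff.1 h).1
          exact hnil (ha ▸ h1 b (by simp))
        | cons a L₂ =>
          simp only [List.flatten_cons] at h
          have hb : b ∈ S := h1 b (by simp)
          have ha : a ∈ S := h2 a (by simp)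
          have hab : b = a := by
            have p1 : b <+: b ++ L₁.flatten := List.prefix_append _ _
            have p2 : a <+: b ++ L₁.flatten := h ▸ List.prefix_append _ _
            rcases List.prefix_or_prefix_of_prefix p1 p2 with h3 | h3
            · exact hS b hb a ha h3
            · exact (hS a ha b hb h3).symm
          subst hab
          rw [ih L₂ (fun w hw => h1 w (by simp [hw])) (fun w hw => h2 w (by simp [hw]))
            (List.append_cancel_left h)]
    have := InformationTheory.kraft_mcmillan_inequality hU
    simpa using this

theorem wsum_le_one {C : Computer} {c : Code} (hc : IsCodeOf c C) (t : ℕ) :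
    (wsum c t : ℝ) / 2 ^ t ≤ 1 := by
  rw [wsum_eq]
  apply kraft_prefixFree
  intro p hp q hq h
  exact C.prefixFree p q (haltSet_dom hc hp) (haltSet_dom hc hq) h

theorem wsum_mono (c : Code) {t t' : ℕ} (h : t ≤ t') :
    (wsum c t : ℝ) / 2 ^ t ≤ (wsum c t' : ℝ) / 2 ^ t' := by
  rw [wsum_eq, wsum_eq]
  exact Finset.sum_le_sum_of_subset_of_nonneg (haltSet_mono c h) (fun _ _ _ => by positivity)

/-- A halting program that has not been seen yet contributes later on. -/
theorem wsum_late {C : Computer} {c : Code} (hc : IsCodeOf c C) (t : ℕ) (p : Str)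
    (hp : (C.f p).Dom) (hn : p ∉ haltSet c t) :
    ∃ t', (wsum c t : ℝ) / 2 ^ t + (1 / 2 : ℝ) ^ p.length ≤ (wsum c t' : ℝ) / 2 ^ t' := by
  obtain ⟨s, hs⟩ := Part.dom_iff_mem.1 hp
  have hv := (hc p (Encodable.encode s)).2 ⟨s, hs, rfl⟩
  obtain ⟨k, hk⟩ := Code.evaln_complete.1 hv
  have hk' : p ∈ haltSet c k := by
    rw [mem_haltSet]; exact Option.isSome_iff_exists.2 ⟨_, hk⟩
  refine ⟨max t k, ?_⟩
  rw [wsum_eq, wsum_eq, add_comm, ← Finset.sum_insert (f := fun p : Str => (1 / 2 : ℝ) ^ p.length) hn]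
  refine Finset.sum_le_sum_of_subset_of_nonneg ?_ (fun _ _ _ => by positivity)
  rw [Finset.insert_subset_iff]
  exact ⟨haltSet_mono c (le_max_right t k) hk', haltSet_mono c (le_max_left t k)⟩

/-- Stage approximations of the modified universal probability, scaled by `4 ^ (t + 1)`. -/
def xnum (c : Code) (t i : ℕ) : ℕ :=
  if i = 0 then 4 ^ t + wsum c t * 2 ^ t
  else if (Encodable.decode₂ Str i).isSome = true then 2 * am t i else 0

theorem primrec_xnum (c : Code) : Primrec₂ (xnum c) := by
  refine Primrec.ite (Primrec.eq.comp Primrec.snd (Primrec.const 0)) ?_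
    (Primrec.ite (Primrec.eq.comp (Primrec.option_isSome.comp (Primrec.decode₂.comp Primrec.snd))
      (Primrec.const true)) ?_ (Primrec.const 0))
  · exact Primrec.nat_add.comp (primrec_pow.comp (Primrec.const 4) Primrec.fst)
      (Primrec.nat_mul.comp ((primrec_wsum c).comp Primrec.fst)
        (primrec_pow.comp (Primrec.const 2) Primrec.fst))
  · exact Primrec.nat_mul.comp (Primrec.const 2) (primrec_am.comp Primrec.fst Primrec.snd)

/-- Stage approximations of the modified universal probability. -/
noncomputable def xr (c : Code) (t i : ℕ) : ℝ := (xnum c t i : ℝ) / 4 ^ (t + 1)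

theorem xr_nonneg (c : Code) (t i : ℕ) : 0 ≤ xr c t i := by unfold xr; positivity

theorem xr_zero (c : Code) (t : ℕ) : xr c t 0 = 1 / 4 + ((wsum c t : ℝ) / 2 ^ t) / 4 := by
  have h4 : (4 : ℝ) ^ t = 2 ^ t * 2 ^ t := by rw [← mul_pow]; norm_num
  simp only [xr, xnum, if_true]
  push_cast
  rw [pow_succ, h4]
  field_simp

theorem xr_le_am (c : Code) (t i : ℕ) (hi : i ≠ 0) : xr c t i ≤ (am t i : ℝ) / 4 ^ t / 2 := by
  simp only [xr, xnum, if_neg hi]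
  split_ifs
  · apply le_of_eq
    push_cast; rw [pow_succ]; field_simp; ring
  · simp; positivity

theorem xr_eq_am (c : Code) (t : ℕ) (s : Str) (hi : s ≠ []) :
    xr c t (Encodable.encode s) = (am t (Encodable.encode s) : ℝ) / 4 ^ t / 2 := by
  have h0 : Encodable.encode s ≠ 0 := by
    cases s with
    | nil => exact absurd rfl hi
    | cons a l => simp
  simp only [xr, xnum, if_neg h0, Encodable.encodek₂, Option.isSome_some, if_true]
  push_cast; rw [pow_succ]; field_simp; ring

theorem xr_mono (c : Code) (i : ℕ) : Monotone (fun t => xr c t i) := by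
  apply monotone_nat_of_le_succ
  intro t
  by_cases hi : i = 0
  · subst hi
    rw [xr_zero, xr_zero]
    have := wsum_mono c (Nat.le_succ t)
    simp only [Nat.succ_eq_add_one] at this
    linarith
  · simp only [xr, xnum, if_neg hi]
    split_ifs
    · have h : (4 * am t i : ℝ) ≤ am (t + 1) i := by exact_mod_cast am_mono t i
      rw [div_le_div_iff₀ (by positivity) (by positivity), pow_succ _ (t + 1)]
      push_cast
      have h4 : (0 : ℝ) < 4 ^ (t + 1) := by positivity
      nlinarith
    · simp

theorem xr_sum_le {C : Computer} {c : Code} (hc : IsCodeOf c C) (t N : ℕ) :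
    ∑ i ∈ Finset.range N, xr c t i ≤ 1 := by
  have h1 : ∑ i ∈ Finset.range N, xr c t i ≤
      ∑ i ∈ Finset.range N, ((if i = 0 then 1 / 2 else 0) + (am t i : ℝ) / 4 ^ t / 2) := by
    refine Finset.sum_le_sum (fun i _ => ?_)
    split_ifs with h
    · subst h
      rw [xr_zero]
      have := wsum_le_one hc t
      have : (0 : ℝ) ≤ (am t 0 : ℝ) / 4 ^ t / 2 := by positivity
      linarith
    · rw [zero_add]; exact xr_le_am c t i h
  have h2 : ∑ i ∈ Finset.range N, (am t i : ℝ) / 4 ^ t ≤ 1 := by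
    rw [← Finset.sum_div, div_le_one (by positivity)]
    exact_mod_cast am_sum t N
  have h3 : ∑ i ∈ Finset.range N, (if i = 0 then (1 / 2 : ℝ) else 0) ≤ 1 / 2 := by
    rw [Finset.sum_ite_eq' (Finset.range N) 0 (fun _ => (1 / 2 : ℝ))]
    split_ifs <;> norm_num
  rw [Finset.sum_add_distrib, ← Finset.sum_div] at h1
  linarith

theorem xr_le_one {C : Computer} {c : Code} (hc : IsCodeOf c C) (t i : ℕ) : xr c t i ≤ 1 :=
  le_trans (Finset.single_le_sum (f := fun i => xr c t i) (fun j _ => xr_nonneg c t j)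
    (Finset.mem_range.2 (Nat.lt_succ_self i))) (xr_sum_le hc t (i + 1))

/-- The modified universal probability, on codes of strings. -/
noncomputable def xl (c : Code) (i : ℕ) : ℝ := ⨆ t, xr c t i

theorem bddAbove_xr {C : Computer} {c : Code} (hc : IsCodeOf c C) (i : ℕ) :
    BddAbove (Set.range (fun t => xr c t i)) :=
  ⟨1, by rintro _ ⟨t, rfl⟩; exact xr_le_one hc t i⟩

theorem xr_le_xl {C : Computer} {c : Code} (hc : IsCodeOf c C) (t i : ℕ) : xr c t i ≤ xl c i :=
  le_ciSup (bddAbove_xr hc i) t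

theorem tendsto_xr {C : Computer} {c : Code} (hc : IsCodeOf c C) (i : ℕ) :
    Tendsto (fun t => xr c t i) atTop (𝓝 (xl c i)) :=
  tendsto_atTop_ciSup (xr_mono c i) (bddAbove_xr hc i)

theorem xl_nonneg {C : Computer} {c : Code} (hc : IsCodeOf c C) (i : ℕ) : 0 ≤ xl c i :=
  le_trans (xr_nonneg c 0 i) (xr_le_xl hc 0 i)

theorem xl_le_one {C : Computer} {c : Code} (hc : IsCodeOf c C) (i : ℕ) : xl c i ≤ 1 :=
  ciSup_le (fun t => xr_le_one hc t i)

theorem xl_sum_le {C : Computer} {c : Code} (hc : IsCodeOf c C) (F : Finset ℕ) :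
    ∑ i ∈ F, xl c i ≤ 1 := by
  have h : ∀ N, ∑ i ∈ Finset.range N, xl c i ≤ 1 := fun N =>
    le_of_tendsto (tendsto_finsetSum _ (fun i _ => tendsto_xr hc i))
      (Eventually.of_forall (fun t => xr_sum_le hc t N))
  obtain ⟨N, hN⟩ := F.exists_nat_subset_range
  exact le_trans (Finset.sum_le_sum_of_subset_of_nonneg hN (fun i _ _ => xl_nonneg hc i)) (h N)

theorem xl_eq_zero (c : Code) (i : ℕ) (hi : i ∉ Set.range (Encodable.encode : Str → ℕ)) :
    xl c i = 0 := by
  have h0 : i ≠ 0 := by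
    rintro rfl
    exact hi ⟨[], rfl⟩
  have h1 : Encodable.decode₂ Str i = none := by
    by_contra hne
    exact hi (Encodable.decode₂_ne_none_iff.1 hne)
  have : ∀ t, xr c t i = 0 := by
    intro t
    simp [xr, xnum, h0, h1]
  simp [xl, this]

theorem xl_zero_late {C : Computer} {c : Code} (hc : IsCodeOf c C) (t : ℕ) (p : Str)
    (hp : (C.f p).Dom) (hn : p ∉ haltSet c t) :
    (1 / 2 : ℝ) ^ p.length ≤ 4 * (xl c 0 - xr c t 0) := by
  obtain ⟨t', ht'⟩ := wsum_late hc t p hp hn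
  have h1 := xr_le_xl hc t' 0
  rw [xr_zero] at h1 ⊢
  linarith


/-! ### Part 4: the modified function is a universal probability -/

open Nat.Partrec (Code)

/-- The universal probability of the theorem. -/
noncomputable def mU (c : Code) (s : Str) : ℝ := xl c (Encodable.encode s)

/-- The stage denominators minus one. -/
def xden (t : ℕ) : ℕ := 4 ^ (t + 1) - 1

theorem xden_add_one (t : ℕ) : xden t + 1 = 4 ^ (t + 1) :=
  Nat.sub_add_cancel (Nat.one_le_pow _ _ (by norm_num))

theorem primrec_xden : Primrec xden :=
  Primrec.nat_sub.comp (primrec_pow.comp (Primrec.const 4) Primrec.succ) (Primrec.const 1)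

theorem computable_xapprox (c : Code) : Computable₂ (fun (t : ℕ) (s : Str) =>
    (xnum c t (Encodable.encode s) : ℚ) / ((xden t + 1 : ℕ) : ℚ)) := by
  have h1 : Primrec (fun p : ℕ × Str => xnum c p.1 (Encodable.encode p.2)) :=
    (primrec_xnum c).comp Primrec.fst (Primrec.encode.comp Primrec.snd)
  have h2 : Primrec (fun p : ℕ × Str => xden p.1) := primrec_xden.comp Primrec.fst
  have h3 : Computable (fun p : ℕ × Str => (xnum c p.1 (Encodable.encode p.2), xden p.1)) :=
    (h1.pair h2).to_comp
  have h4 := computable_mkRat.comp h3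
  refine Computable.of_eq h4 (fun p => ?_)
  rfl

theorem mU_lc {C : Computer} {c : Code} (hc : IsCodeOf c C) : LCSemiMeasure (mU c) := by
  refine ⟨⟨fun s => ⟨xl_nonneg hc _, xl_le_one hc _⟩, fun F => ?_⟩, ?_⟩
  · have := xl_sum_le hc (F.image (Encodable.encode : Str → ℕ))
    rwa [Finset.sum_image (fun a _ b _ h => Encodable.encode_injective h)] at this
  · refine ⟨fun t s => (xnum c t (Encodable.encode s) : ℚ) / ((xden t + 1 : ℕ) : ℚ), ?_, ?_⟩
    · exact computable_xapprox c
    · intro s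
      have he : ∀ n, ((((xnum c n (Encodable.encode s) : ℚ) / ((xden n + 1 : ℕ) : ℚ)) : ℚ) : ℝ)
          = xr c n (Encodable.encode s) := by
        intro n
        rw [xden_add_one]
        simp [xr]
      refine ⟨fun n => ⟨by positivity, ?_⟩, ?_⟩
      · rw [he]; exact xr_le_xl hc n _
      · simp only [he]; exact tendsto_xr hc _

theorem mU_universal {C : Computer} {c : Code} (hc : IsCodeOf c C) : UniversalProb (mU c) := by
  refine ⟨mU_lc hc, ?_⟩
  rintro r ⟨⟨hr1, hr2⟩, f, hf, hfr⟩
  set r' : ℕ → ℝ := fun i => ((Encodable.decode₂ Str i).map r).getD 0 with hr'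
  have hr'e : ∀ s, r' (Encodable.encode s) = r s := by
    intro s; simp [hr', Encodable.encodek₂]
  have hr'n : ∀ i, i ∉ Set.range (Encodable.encode : Str → ℕ) → r' i = 0 := by
    intro i hi
    have h1 : Encodable.decode₂ Str i = none := by
      by_contra hne
      exact hi (Encodable.decode₂_ne_none_iff.1 hne)
    simp [hr', h1]
  set g : ℕ → Str → ℕ := fun n s => (f n s).num.toNat * 2 ^ n / (f n s).den with hg
  have hgc : Computable (fun p : ℕ × Str => g p.1 p.2) := by
    have h1 : Computable (fun p : ℕ × Str => f p.1 p.2) := hf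
    have h2 : Primrec (fun x : (ℕ × ℕ) × ℕ => x.1.1 * 2 ^ x.2 / x.1.2) :=
      Primrec.nat_div.comp (Primrec.nat_mul.comp (Primrec.fst.comp Primrec.fst)
        (primrec_pow.comp (Primrec.const 2) Primrec.snd)) (Primrec.snd.comp Primrec.fst)
    exact h2.to_comp.comp (((computable_num.comp h1).pair (computable_den.comp h1)).pair
      Computable.fst)
  set φ : ℕ → ℕ → ℕ := fun n i => ((Encodable.decode₂ Str i).map (g n)).getD 0 with hφ
  have hφc : Computable₂ φ := by
    refine Computable.option_getD (Computable.option_map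
      (Primrec.decode₂.to_comp.comp Computable.snd) ?_) (Computable.const 0)
    exact (hgc.comp ((Computable.fst.comp Computable.fst).pair Computable.snd)).to₂
  have hgr : ∀ n s, ((f n s).num.toNat * 2 ^ n : ℕ) / ((f n s).den : ℝ) = f n s * 2 ^ n := by
    intro n s
    have h0 := ((hfr s).1 n).1
    have hn : (((f n s).num.toNat : ℕ) : ℝ) = ((f n s).num : ℝ) := by
      have := Int.toNat_of_nonneg (Rat.num_nonneg.2 h0)
      exact_mod_cast this
    have hd : ((f n s : ℚ) : ℝ) = (f n s).num / (f n s).den := by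
      exact_mod_cast (Rat.num_div_den (f n s)).symm
    rw [hd]
    push_cast
    rw [hn]
    ring
  have hgle : ∀ n s, (g n s : ℝ) / 2 ^ n ≤ f n s := by
    intro n s
    rw [div_le_iff₀ (by positivity), ← hgr]
    exact Nat.cast_div_le
  have hgge : ∀ n s, (f n s : ℝ) ≤ (g n s : ℝ) / 2 ^ n + (1 / 2) ^ n := by
    intro n s
    have : (f n s : ℝ) * 2 ^ n ≤ g n s + 1 := by
      rw [← hgr, div_le_iff₀ (by exact_mod_cast (f n s).pos)]
      have := Nat.lt_div_mul_add (a := (f n s).num.toNat * 2 ^ n) (f n s).pos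
      have h2 : (f n s).num.toNat * 2 ^ n ≤ (g n s + 1) * (f n s).den := by
        rw [add_mul, one_mul]; exact this.le
      exact_mod_cast h2
    rw [one_div, inv_pow, ← one_div, ← add_div, le_div_iff₀ (by positivity)]
    exact this
  have hle : ∀ n i, (φ n i : ℝ) / 2 ^ n ≤ r' i := by
    intro n i
    by_cases hi : i ∈ Set.range (Encodable.encode : Str → ℕ)
    · obtain ⟨s, rfl⟩ := hi
      rw [hr'e]
      simp only [hφ, Encodable.encodek₂, Option.map_some, Option.getD_some]
      exact le_trans (hgle n s) ((hfr s).1 n).2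
    · have h1 : Encodable.decode₂ Str i = none := by
        by_contra hne
        exact hi (Encodable.decode₂_ne_none_iff.1 hne)
      simp [hφ, hr', h1]
  have hsum : ∀ F : Finset ℕ, ∑ i ∈ F, r' i ≤ 1 := by
    intro F
    rw [← Finset.sum_preimage (Encodable.encode : Str → ℕ) F
      (Encodable.encode_injective.injOn) r' (fun i _ hi => hr'n i hi)]
    simp only [hr'e]
    exact hr2 _
  have hr'0 : ∀ i, 0 ≤ r' i := by
    intro i
    by_cases hi : i ∈ Set.range (Encodable.encode : Str → ℕ)
    · obtain ⟨s, rfl⟩ := hi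
      rw [hr'e]; exact (hr1 s).1
    · rw [hr'n i hi]
  obtain ⟨e, he⟩ := am_dominates r' hr'0 hsum φ hφc hle
  refine ⟨1 / 2 ^ (e + 2), by positivity, fun s => ?_⟩
  by_cases hs : s = []
  · subst hs
    have h1 : (1 / 4 : ℝ) ≤ mU c [] := by
      refine le_trans ?_ (xr_le_xl hc 0 _)
      have : Encodable.encode ([] : Str) = 0 := rfl
      rw [this, xr_zero]
      have : (0 : ℝ) ≤ (wsum c 0 : ℝ) / 2 ^ 0 / 4 := by positivity
      linarith
    refine le_trans ?_ h1
    have h2 : (1 : ℝ) / 2 ^ (e + 2) ≤ 1 / 4 := by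
      rw [pow_add]
      apply one_div_le_one_div_of_le (by norm_num)
      have : (1 : ℝ) ≤ 2 ^ e := one_le_pow₀ (by norm_num)
      linarith
    have := hr1 []
    have h3 : (0 : ℝ) < 1 / 2 ^ (e + 2) := by positivity
    nlinarith
  · have key : ∀ n, (f n s : ℝ) ≤ 2 ^ (e + 2) * mU c s + (1 / 2) ^ n := by
      intro n
      refine le_trans (hgge n s) ?_
      have : (g n s : ℝ) / 2 ^ n ≤ 2 ^ (e + 2) * mU c s := by
        obtain ⟨t, ht⟩ := he n (Encodable.encode s)
        have hx := xr_le_xl hc t (Encodable.encode s)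
        rw [xr_eq_am c t s hs] at hx
        simp only [hφ, Encodable.encodek₂, Option.map_some, Option.getD_some] at ht
        have ht' : (g n s : ℝ) * 4 ^ t ≤ am t (Encodable.encode s) * 2 ^ (n + e + 1) := by
          exact_mod_cast ht
        refine le_trans ?_ (mul_le_mul_of_nonneg_left hx (by positivity))
        have h5 : (2 : ℝ) ^ (e + 2) * ((am t (Encodable.encode s) : ℝ) / 4 ^ t / 2) =
            (am t (Encodable.encode s) : ℝ) * 2 ^ (e + 1) / 4 ^ t := by
          rw [pow_succ _ (e + 1)]; ring
        rw [h5, div_le_div_iff₀ (by positivity) (by positivity)]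
        refine le_trans ht' (le_of_eq ?_)
        rw [add_assoc, pow_add]; ring
      linarith
    have hlim : r s ≤ 2 ^ (e + 2) * mU c s + 0 := by
      refine le_of_tendsto_of_tendsto' (hfr s).2 (Tendsto.const_add _ ?_) key
      exact tendsto_pow_atTop_nhds_zero_of_lt_one (by norm_num) (by norm_num)
    rw [add_zero] at hlim
    rw [one_div, inv_mul_le_iff₀ (by positivity)]
    exact hlim


/-! ### Part 5: basic facts on complexity and binary prefixes -/

/-- The self-delimiting copy machine, decoding `1^n 0 s` with `|s| = n` to `s`. -/
def copyFun (p : Str) : Option Str :=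
  if p.length = 2 * p.idxOf false + 1 then some (p.drop (p.idxOf false + 1)) else none

theorem primrec_copyFun : Primrec copyFun := by
  have h1 : Primrec (fun p : Str => p.idxOf false) :=
    Primrec.list_idxOf.comp (Primrec.const false) Primrec.id
  refine Primrec.ite (Primrec.eq.comp Primrec.list_length
    (Primrec.succ.comp (Primrec.nat_mul.comp (Primrec.const 2) h1))) ?_ (Primrec.const none)
  exact Primrec.option_some.comp (Primrec.list_drop.comp (Primrec.succ.comp h1) Primrec.id)

theorem copyFun_prefixFree (p q : Str) (hp : (copyFun p).isSome = true) (hq : (copyFun q).isSome = true)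
    (h : p <+: q) : p = q := by
  have h1 : p.length = 2 * p.idxOf false + 1 := by
    by_contra hn; simp [copyFun, hn] at hp
  have h2 : q.length = 2 * q.idxOf false + 1 := by
    by_contra hn; simp [copyFun, hn] at hq
  have hm : false ∈ p := by
    rw [← List.idxOf_lt_length_iff]; omega
  obtain ⟨r, rfl⟩ := h
  have h3 : (p ++ r).idxOf false = p.idxOf false := List.idxOf_append_of_mem hm
  apply List.IsPrefix.eq_of_length (List.prefix_append _ _)
  omega

/-- The copy machine as a computer. -/
def copyComputer : Computer where
  f := fun p => (copyFun p : Part Str)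
  partrec := (Primrec.to_comp primrec_copyFun).ofOption
  prefixFree := by
    intro p q hp hq h
    refine copyFun_prefixFree p q ?_ ?_ h
    · simpa using hp
    · simpa using hq

theorem copyFun_spec (s : Str) : copyFun (List.replicate s.length true ++ false :: s) = some s := by
  have h : (List.replicate s.length true ++ false :: s).idxOf false = s.length := by
    rw [List.idxOf_append_of_notMem (by simp)]
    simp
  unfold copyFun
  rw [h, if_pos (by simp; omega)]
  congr 1
  rw [List.drop_append]
  simp

theorem exists_copy (U : OptimalComputer) :
    ∃ k : ℕ, ∀ s : Str, ∃ p, s ∈ U.f p ∧ p.length ≤ 2 * s.length + 1 + k := by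
  obtain ⟨k, hk⟩ := U.optimal copyComputer
  refine ⟨k, fun s => ?_⟩
  obtain ⟨p, hp, hl⟩ := hk (List.replicate s.length true ++ false :: s) s (by
    show s ∈ (copyFun _ : Part Str)
    rw [copyFun_spec]; simp)
  refine ⟨p, hp, le_trans hl (by simp; omega)⟩

theorem exists_minimal (U : OptimalComputer) (s : Str) :
    ∃ p : Str, p.length = Kc U s ∧ s ∈ U.f p := by
  have hne : {n | ∃ p : Str, p.length = n ∧ s ∈ U.f p}.Nonempty := by
    obtain ⟨k, hk⟩ := exists_copy U
    obtain ⟨p, hp, -⟩ := hk s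
    exact ⟨_, p, rfl, hp⟩
  exact Nat.sInf_mem hne

theorem Kc_le (U : OptimalComputer) : ∃ k : ℕ, ∀ s : Str, Kc U s ≤ 2 * s.length + 1 + k := by
  obtain ⟨k, hk⟩ := exists_copy U
  refine ⟨k, fun s => ?_⟩
  obtain ⟨p, hp, hl⟩ := hk s
  exact le_trans (Nat.sInf_le ⟨p, rfl, hp⟩) hl

/-- Value of a binary string, most significant bit first. -/
def strVal (s : Str) : ℕ := s.foldl (fun a b => 2 * a + b.toNat) 0

theorem primrec_strVal : Primrec strVal := by
  have ht : Primrec Bool.toNat := Primrec.dom_finite _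
  have h : Primrec₂ (fun (_ : Str) (x : ℕ × Bool) => 2 * x.1 + x.2.toNat) :=
    (Primrec.nat_add.comp (Primrec.nat_mul.comp (Primrec.const 2)
      (Primrec.fst.comp Primrec.snd)) (ht.comp (Primrec.snd.comp Primrec.snd))).to₂
  exact Primrec.list_foldl Primrec.id (Primrec.const 0) h

theorem length_binPrefix (T : ℝ) (n : ℕ) : (binPrefix T n).length = n := by
  simp [binPrefix]

theorem strVal_binPrefix (T : ℝ) (n : ℕ) :
    ((strVal (binPrefix T n) : ℕ) : ℤ) = ⌊Int.fract T * 2 ^ n⌋ := by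
  induction n with
  | zero =>
    simp [binPrefix, strVal]
  | succ n ih =>
    have h1 : binPrefix T (n + 1) = binPrefix T n ++
        [decide (⌊Int.fract T * 2 ^ (n + 1)⌋ % 2 = 1)] := by
      simp [binPrefix, List.range_succ]
    have h2 : strVal (binPrefix T (n + 1)) = 2 * strVal (binPrefix T n) +
        (decide (⌊Int.fract T * 2 ^ (n + 1)⌋ % 2 = 1)).toNat := by
      rw [h1]; simp [strVal, List.foldl_append]
    rw [h2]
    push_cast
    rw [ih]
    have h3 : ⌊Int.fract T * 2 ^ n⌋ = ⌊Int.fract T * 2 ^ (n + 1)⌋ / 2 := by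
      have : Int.fract T * 2 ^ n = Int.fract T * 2 ^ (n + 1) / ((2 : ℕ) : ℝ) := by
        rw [pow_succ]; push_cast; ring
      rw [this, Int.floor_div_natCast]; rfl
    rw [h3]
    by_cases h : ⌊Int.fract T * 2 ^ (n + 1)⌋ % 2 = 1
    · simp only [h, decide_true, Bool.toNat_true]; push_cast; omega
    · simp only [h, decide_false, Bool.toNat_false]; push_cast; omega

theorem strVal_bounds (T : ℝ) (hT : 0 ≤ T) (n : ℕ) :
    ((⌊T⌋₊ : ℝ) * 2 ^ n + strVal (binPrefix T n)) ≤ T * 2 ^ n ∧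
      T * 2 ^ n < (⌊T⌋₊ : ℝ) * 2 ^ n + strVal (binPrefix T n) + 1 := by
  have h := strVal_binPrefix T n
  have h0 : ((strVal (binPrefix T n) : ℕ) : ℝ) = (⌊Int.fract T * 2 ^ n⌋ : ℝ) := by
    exact_mod_cast h
  have h1 := Int.floor_le (Int.fract T * 2 ^ n)
  have h2 := Int.lt_floor_add_one (Int.fract T * 2 ^ n)
  have h3 : T = (⌊T⌋₊ : ℝ) + Int.fract T := by
    have h4 : ((⌊T⌋₊ : ℕ) : ℝ) = (⌊T⌋ : ℝ) := by
      rw [← Int.natCast_floor_eq_floor hT]; simp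
    rw [h4]; exact (Int.floor_add_fract T).symm
  rw [h0]
  have h5 : T * 2 ^ n = (⌊T⌋₊ : ℝ) * 2 ^ n + Int.fract T * 2 ^ n := by
    rw [← add_mul, ← h3]
  rw [h5]
  constructor <;> linarith

/-- A string whose truncations have complexity at least `n - c` is not compressible. -/
theorem not_compressible (U : OptimalComputer) (T q : ℝ) (hq : 1 < q)
    (h : ∃ c : ℕ, ∀ n : ℕ, (n : ℝ) - c ≤ Kc U (binPrefix T n)) : ¬ DCompressible U (1 / q) T := by
  intro hD
  obtain ⟨c, hc⟩ := h
  obtain ⟨k, hk⟩ := Kc_le U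
  have hq1 : 1 / q < 1 := by rw [div_lt_one (by linarith)]; exact hq
  obtain ⟨d, hd1, hd2⟩ := exists_between hq1
  have hb : IsBoundedUnder (· ≤ ·) atTop (fun n : ℕ => (Kc U (binPrefix T n) : ℝ) / n) := by
    refine isBoundedUnder_of ⟨3 + k, fun n => ?_⟩
    rcases Nat.eq_zero_or_pos n with h0 | h0
    · subst h0; simp; positivity
    · have hn : (1 : ℝ) ≤ n := by exact_mod_cast h0
      rw [div_le_iff₀ (by linarith)]
      have h1 := hk (binPrefix T n)
      rw [length_binPrefix] at h1
      have h2 : (Kc U (binPrefix T n) : ℝ) ≤ 2 * n + 1 + k := by exact_mod_cast h1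
      have hk0 : (0 : ℝ) ≤ k := Nat.cast_nonneg k
      nlinarith
  have hev := eventually_lt_of_limsup_lt (lt_of_le_of_lt hD hd1) hb
  obtain ⟨N, hN⟩ := exists_nat_gt (c / (1 - d))
  obtain ⟨n, hn1, hn2⟩ := (hev.and (eventually_ge_atTop (max N 1))).exists
  have hn : (1 : ℝ) ≤ n := by exact_mod_cast le_trans (le_max_right N 1) hn2
  have hnN : (N : ℝ) ≤ n := by exact_mod_cast le_trans (le_max_left N 1) hn2
  rw [div_lt_iff₀ (by linarith)] at hn1
  have h1 := hc n
  rw [div_lt_iff₀ (by linarith)] at hN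
  nlinarith

/-! ### Part 6: rational lower bounds for the power sum -/

open Nat.Partrec (Code)

theorem exists_upper_approx (q : ℝ) (hq : 1 < q) (h : ComputableReal q) :
    ∃ g : ℕ → ℕ × ℕ, Computable g ∧ (∀ t, 0 < (g t).2) ∧
      (∀ t, q ≤ ((g t).1 : ℝ) / ((g t).2 : ℝ)) ∧
      Tendsto (fun t => ((g t).1 : ℝ) / ((g t).2 : ℝ)) atTop (𝓝 q) := by
  obtain ⟨f, hf, hfq⟩ := h
  have hpos : ∀ t, 0 < f t := by
    intro t
    have h1 := (abs_lt.1 (hfq t)).2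
    have h2 : (2 : ℝ)⁻¹ ^ t ≤ 1 := pow_le_one₀ (by norm_num) (by norm_num)
    have : (0 : ℝ) < f t := by linarith
    exact_mod_cast this
  have hval : ∀ t, (((f t).num.toNat * 2 ^ t + (f t).den : ℕ) : ℝ) / (((f t).den * 2 ^ t : ℕ) : ℝ)
      = f t + (2 : ℝ)⁻¹ ^ t := by
    intro t
    have hn : (((f t).num.toNat : ℕ) : ℝ) = ((f t).num : ℝ) := by
      have := Int.toNat_of_nonneg (Rat.num_nonneg.2 (hpos t).le)
      exact_mod_cast this
    have hd : ((f t : ℚ) : ℝ) = (f t).num / (f t).den := by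
      exact_mod_cast (Rat.num_div_den (f t)).symm
    have hd0 : ((f t).den : ℝ) ≠ 0 := by exact_mod_cast (f t).den_nz
    rw [hd]
    push_cast
    rw [hn, inv_pow]
    field_simp
  refine ⟨fun t => ((f t).num.toNat * 2 ^ t + (f t).den, (f t).den * 2 ^ t), ?_, ?_, ?_, ?_⟩
  · have h2 : Primrec (fun x : (ℕ × ℕ) × ℕ => (x.1.1 * 2 ^ x.2 + x.1.2, x.1.2 * 2 ^ x.2)) := by
      have hp : Primrec (fun x : (ℕ × ℕ) × ℕ => 2 ^ x.2) :=
        primrec_pow.comp (Primrec.const 2) Primrec.snd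
      have ha : Primrec (fun x : (ℕ × ℕ) × ℕ => x.1.1) := Primrec.fst.comp Primrec.fst
      have hb : Primrec (fun x : (ℕ × ℕ) × ℕ => x.1.2) := Primrec.snd.comp Primrec.fst
      exact (Primrec.nat_add.comp (Primrec.nat_mul.comp ha hp) hb).pair
        (Primrec.nat_mul.comp hb hp)
    exact h2.to_comp.comp (((computable_num.comp hf).pair (computable_den.comp hf)).pair
      Computable.id)
  · intro t
    exact Nat.mul_pos (f t).pos (by positivity)
  · intro t
    rw [hval]
    have h1 := (abs_lt.1 (hfq t)).2
    linarith
  · simp only [hval]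
    have h0 : Tendsto (fun t : ℕ => (2 : ℝ)⁻¹ ^ t) atTop (𝓝 0) :=
      tendsto_pow_atTop_nhds_zero_of_lt_one (by norm_num) (by norm_num)
    have h1 : Tendsto (fun t => (f t : ℝ)) atTop (𝓝 q) := by
      rw [tendsto_iff_dist_tendsto_zero]
      refine squeeze_zero (fun _ => dist_nonneg) (fun t => ?_) h0
      rw [dist_comm, Real.dist_eq]
      exact (hfq t).le
    simpa using h1.add h0

/-- The list `rs` certifies lower bounds of the powers of the stage approximations. -/
def RootOK (c : Code) (t a b : ℕ) (rs : List ℕ) : Prop :=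
  ∀ i < rs.length, rs.getD i 0 ^ b * (4 ^ (t + 1)) ^ a ≤ xnum c t i ^ a * (4 ^ (t + 1)) ^ b

theorem root_iff (x r D a b : ℕ) (hD : 0 < D) (hb : 0 < b) :
    r ^ b * D ^ a ≤ x ^ a * D ^ b ↔ (r : ℝ) / D ≤ ((x : ℝ) / D) ^ ((a : ℝ) / b) := by
  have hD' : (0 : ℝ) < D := by exact_mod_cast hD
  have hb' : (b : ℝ) ≠ 0 := by exact_mod_cast hb.ne'
  have h1 : ((x : ℝ) / D) ^ ((a : ℝ) / b) = (((x : ℝ) / D) ^ a) ^ ((b : ℝ)⁻¹) := by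
    rw [← Real.rpow_natCast, ← Real.rpow_mul (by positivity), div_eq_mul_inv (a : ℝ)]
  have h2 : ((((x : ℝ) / D) ^ a) ^ ((b : ℝ)⁻¹)) ^ b = ((x : ℝ) / D) ^ a := by
    rw [← Real.rpow_natCast (_ ^ ((b : ℝ)⁻¹)), ← Real.rpow_mul (by positivity),
      inv_mul_cancel₀ hb', Real.rpow_one]
  rw [h1, ← pow_le_pow_iff_left₀ (a := (r : ℝ) / D) (n := b) (by positivity) (by positivity) hb.ne', h2,
    div_pow, div_pow, div_le_div_iff₀ (by positivity) (by positivity)]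
  exact_mod_cast Iff.rfl

theorem sum_eq_getD (rs : List ℕ) : rs.sum = ∑ i ∈ Finset.range rs.length, rs.getD i 0 := by
  induction rs with
  | nil => simp
  | cons a l ih =>
    rw [List.length_cons, Finset.sum_range_succ', List.sum_cons, ih, add_comm]
    simp


theorem xl_summable {C : Computer} {c : Code} (hc : IsCodeOf c C) : Summable (xl c) :=
  summable_of_sum_le (xl_nonneg hc) (xl_sum_le hc)

theorem xlq_summable {C : Computer} {c : Code} (hc : IsCodeOf c C) {q : ℝ} (hq : 1 < q) :
    Summable (fun i => xl c i ^ q) := by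
  refine Summable.of_nonneg_of_le (fun i => Real.rpow_nonneg (xl_nonneg hc i) q) (fun i => ?_)
    (xl_summable hc)
  exact Real.rpow_le_self_of_le_one (xl_nonneg hc i) (xl_le_one hc i) hq.le

theorem tsum_mU {C : Computer} {c : Code} (_ : IsCodeOf c C) {q : ℝ} (hq : 1 < q) :
    ∑' s, mU c s ^ q = ∑' i, xl c i ^ q := by
  refine Function.Injective.tsum_eq (g := (Encodable.encode : Str → ℕ))
    (f := fun i => xl c i ^ q) Encodable.encode_injective ?_
  intro i hi
  by_contra hn
  apply hi
  show xl c i ^ q = 0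
  rw [xl_eq_zero c i hn, Real.zero_rpow (by linarith)]

theorem root_sound {C : Computer} {c : Code} (hc : IsCodeOf c C) {q : ℝ} (hq : 1 < q)
    {t a b : ℕ} {rs : List ℕ} (hb : 0 < b) (hab : q ≤ (a : ℝ) / b) (h : RootOK c t a b rs) :
    (rs.sum : ℝ) / 4 ^ (t + 1) ≤ xr c t 0 ^ q + (∑' i, xl c i ^ q) - xl c 0 ^ q := by
  have h1 : ∀ i < rs.length, (rs.getD i 0 : ℝ) / 4 ^ (t + 1) ≤ xr c t i ^ q := by
    intro i hi
    have h2 := (root_iff _ _ _ _ _ (by positivity) hb).1 (h i hi)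
    push_cast at h2
    refine le_trans h2 ?_
    exact Real.rpow_le_rpow_of_exponent_ge_of_imp (xr_nonneg c t i) (xr_le_one hc t i) hab
      (fun _ h0 => by linarith)
  have hs : (rs.sum : ℝ) / 4 ^ (t + 1) ≤ ∑ i ∈ Finset.range rs.length, xr c t i ^ q := by
    rw [sum_eq_getD, Nat.cast_sum, Finset.sum_div]
    exact Finset.sum_le_sum (fun i hi => h1 i (Finset.mem_range.1 hi))
  have h3 : ∑ i ∈ Finset.range rs.length, xr c t i ^ q ≤
      ∑ i ∈ Finset.range (rs.length + 1), xr c t i ^ q := by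
    rw [Finset.sum_range_succ]
    have := Real.rpow_nonneg (xr_nonneg c t rs.length) q
    linarith
  have h4 : ∑ i ∈ Finset.range (rs.length + 1), xl c i ^ q ≤ ∑' i, xl c i ^ q :=
    (xlq_summable hc hq).sum_le_tsum _ (fun i _ => Real.rpow_nonneg (xl_nonneg hc i) q)
  rw [Finset.sum_range_succ'] at h3 h4
  have h5 : ∑ i ∈ Finset.range rs.length, xr c t (i + 1) ^ q ≤
      ∑ i ∈ Finset.range rs.length, xl c (i + 1) ^ q :=
    Finset.sum_le_sum (fun i _ => Real.rpow_le_rpow (xr_nonneg c t _) (xr_le_xl hc t _)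
      (by linarith))
  linarith

theorem root_complete {C : Computer} {c : Code} (hc : IsCodeOf c C) {q : ℝ} (hq : 1 < q)
    {g : ℕ → ℕ × ℕ} (hg : ∀ t, 0 < (g t).2)
    (hgl : Tendsto (fun t => ((g t).1 : ℝ) / ((g t).2 : ℝ)) atTop (𝓝 q)) {ε : ℝ} (hε : 0 < ε) :
    ∃ t rs, RootOK c t (g t).1 (g t).2 rs ∧
      (∑' i, xl c i ^ q) - ε < (rs.sum : ℝ) / 4 ^ (t + 1) := by
  have hS := (xlq_summable hc hq).hasSum.tendsto_sum_nat
  obtain ⟨N, hN⟩ := (hS.eventually (lt_mem_nhds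
    (show (∑' i, xl c i ^ q) - ε < ∑' i, xl c i ^ q by linarith))).exists
  have h4 : Tendsto (fun t : ℕ => (N : ℝ) / 4 ^ (t + 1)) atTop (𝓝 0) := by
    refine Tendsto.const_div_atTop ?_ _
    exact (tendsto_pow_atTop_atTop_of_one_lt (by norm_num)).comp (tendsto_add_atTop_nat 1)
  have hF : Tendsto (fun t => ∑ i ∈ Finset.range N, xr c t i ^ (((g t).1 : ℝ) / ((g t).2 : ℝ))
      - (N : ℝ) / 4 ^ (t + 1)) atTop (𝓝 (∑ i ∈ Finset.range N, xl c i ^ q - 0)) := by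
    refine Tendsto.sub (tendsto_finsetSum _ (fun i _ => ?_)) h4
    exact (tendsto_xr hc i).rpow hgl (Or.inr (by linarith))
  rw [sub_zero] at hF
  obtain ⟨t, ht⟩ := (hF.eventually (lt_mem_nhds hN)).exists
  set r : ℕ → ℕ := fun i => ⌊(4 : ℝ) ^ (t + 1) * xr c t i ^ (((g t).1 : ℝ) / ((g t).2 : ℝ))⌋₊
    with hr
  have hnn : ∀ i, 0 ≤ xr c t i ^ (((g t).1 : ℝ) / ((g t).2 : ℝ)) :=
    fun i => Real.rpow_nonneg (xr_nonneg c t i) _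
  refine ⟨t, (List.range N).map r, ?_, lt_of_lt_of_le ht ?_⟩
  · intro i hi
    have hi' : i < N := by simpa using hi
    have hget : ((List.range N).map r).getD i 0 = r i := by
      simp [hi']
    rw [hget, root_iff _ _ _ _ _ (by positivity) (hg t)]
    push_cast
    rw [div_le_iff₀ (by positivity), mul_comm]
    exact Nat.floor_le (mul_nonneg (by positivity) (hnn i))
  · rw [sum_map_range, Nat.cast_sum, Finset.sum_div, sub_le_iff_le_add]
    have : (N : ℝ) / 4 ^ (t + 1) = ∑ i ∈ Finset.range N, (1 : ℝ) / 4 ^ (t + 1) := by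
      rw [Finset.sum_const, Finset.card_range, nsmul_eq_mul]; ring
    rw [this, ← Finset.sum_add_distrib]
    refine Finset.sum_le_sum (fun i _ => ?_)
    rw [← add_div, le_div_iff₀ (by positivity), mul_comm]
    exact (Nat.lt_floor_add_one _).le

/-- If the certified sum is close to the limit then so is the value at the empty string. -/
theorem late_bound {C : Computer} {c : Code} (hc : IsCodeOf c C) {q : ℝ} (hq : 1 < q)
    {t : ℕ} {p : Str} (hp : (C.f p).Dom) (hn : p ∉ haltSet c t) {S δ : ℝ}
    (hS : S ≤ xr c t 0 ^ q + (∑' i, xl c i ^ q) - xl c 0 ^ q)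
    (hd : (∑' i, xl c i ^ q) - S < δ) : (1 / 2 : ℝ) ^ p.length ≤ (4 : ℝ) ^ q * δ := by
  have h1 := xl_zero_late hc t p hp hn
  have ha : (1 / 4 : ℝ) ≤ xr c t 0 := by
    rw [xr_zero]
    have : (0 : ℝ) ≤ (wsum c t : ℝ) / 2 ^ t / 4 := by positivity
    linarith
  have hab := xr_le_xl hc t 0
  set a := xr c t 0
  set b := xl c 0
  have e1 : ∀ x : ℝ, 0 < x → x ^ q = x * x ^ (q - 1) := by
    intro x hx
    rw [← Real.rpow_one_add' hx.le (by linarith)]; congr 1; ring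
  have h2 : a ^ (q - 1) ≤ b ^ (q - 1) := Real.rpow_le_rpow (by linarith) hab (by linarith)
  have h3 : (1 / 4 : ℝ) ^ (q - 1) ≤ b ^ (q - 1) :=
    le_trans (Real.rpow_le_rpow (by norm_num) ha (by linarith)) h2
  have h4 : (b - a) * (1 / 4 : ℝ) ^ (q - 1) ≤ b ^ q - a ^ q := by
    rw [e1 a (by linarith), e1 b (by linarith)]
    have : a * a ^ (q - 1) ≤ a * b ^ (q - 1) := mul_le_mul_of_nonneg_left h2 (by linarith)
    have : (b - a) * (1 / 4 : ℝ) ^ (q - 1) ≤ (b - a) * b ^ (q - 1) :=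
      mul_le_mul_of_nonneg_left h3 (by linarith)
    linarith
  have h5 : (1 / 4 : ℝ) ^ (q - 1) * 4 ^ q = 4 := by
    rw [one_div, Real.inv_rpow (by norm_num), ← Real.rpow_neg (by norm_num),
      ← Real.rpow_add (by norm_num)]
    have : -(q - 1) + q = 1 := by ring
    rw [this, Real.rpow_one]
  have h6 : (b - a) * (1 / 4 : ℝ) ^ (q - 1) ≤ δ := by linarith
  have h7 := mul_le_mul_of_nonneg_right h6 (show (0 : ℝ) ≤ 4 ^ q by positivity)
  rw [mul_assoc, h5] at h7
  linarith

/-! ### Part 7: the machine that beats the initial segments of the power sum -/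

open Nat.Partrec (Code)

/-- The decidable test performed by the machine. -/
def TestOK (c : Code) (k : ℕ) (x : (ℕ × ℕ) × (Str × (ℕ × List ℕ))) : Prop :=
  RootOK c x.2.2.1 x.1.1 x.1.2 x.2.2.2 ∧
    (k * 2 ^ x.2.1.length + strVal x.2.1) * 4 ^ (x.2.2.1 + 1) <
      x.2.2.2.sum * 2 ^ x.2.1.length + 4 ^ (x.2.2.1 + 1)

theorem primrec_rootOK (c : Code) :
    PrimrecPred (fun x : (ℕ × ℕ) × (ℕ × List ℕ) => RootOK c x.2.1 x.1.1 x.1.2 x.2.2) := by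
  have hR : PrimrecRel (fun (i : ℕ) (x : (ℕ × ℕ) × (ℕ × List ℕ)) =>
      x.2.2.getD i 0 ^ x.1.2 * (4 ^ (x.2.1 + 1)) ^ x.1.1 ≤
        xnum c x.2.1 i ^ x.1.1 * (4 ^ (x.2.1 + 1)) ^ x.1.2) := by
    have ha : Primrec (fun y : ℕ × ((ℕ × ℕ) × (ℕ × List ℕ)) => y.2.1.1) :=
      Primrec.fst.comp (Primrec.fst.comp Primrec.snd)
    have hb : Primrec (fun y : ℕ × ((ℕ × ℕ) × (ℕ × List ℕ)) => y.2.1.2) :=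
      Primrec.snd.comp (Primrec.fst.comp Primrec.snd)
    have ht : Primrec (fun y : ℕ × ((ℕ × ℕ) × (ℕ × List ℕ)) => y.2.2.1) :=
      Primrec.fst.comp (Primrec.snd.comp Primrec.snd)
    have hr : Primrec (fun y : ℕ × ((ℕ × ℕ) × (ℕ × List ℕ)) => y.2.2.2) :=
      Primrec.snd.comp (Primrec.snd.comp Primrec.snd)
    have hD : Primrec (fun y : ℕ × ((ℕ × ℕ) × (ℕ × List ℕ)) => 4 ^ (y.2.2.1 + 1)) :=
      primrec_pow.comp (Primrec.const 4) (Primrec.succ.comp ht)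
    refine Primrec.nat_le.comp ?_ ?_
    · exact Primrec.nat_mul.comp
        (primrec_pow.comp ((Primrec.list_getD 0).comp hr Primrec.fst) hb)
        (primrec_pow.comp hD ha)
    · exact Primrec.nat_mul.comp
        (primrec_pow.comp ((primrec_xnum c).comp ht Primrec.fst) ha)
        (primrec_pow.comp hD hb)
  have h3 := (PrimrecRel.forall_mem_list hR).comp
    (Primrec.list_range.comp (Primrec.list_length.comp (Primrec.snd.comp Primrec.snd)))
    (Primrec.id (α := (ℕ × ℕ) × (ℕ × List ℕ)))
  refine h3.of_eq (fun x => ?_)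
  simp [RootOK]

theorem primrec_testOK (c : Code) (k : ℕ) : PrimrecPred (TestOK c k) := by
  refine PrimrecPred.and ?_ ?_
  · exact (primrec_rootOK c).comp (Primrec.fst.pair (Primrec.snd.comp Primrec.snd))
  · have hs : Primrec (fun x : (ℕ × ℕ) × (Str × (ℕ × List ℕ)) => x.2.1) :=
      Primrec.fst.comp Primrec.snd
    have h2 : Primrec (fun x : (ℕ × ℕ) × (Str × (ℕ × List ℕ)) => 2 ^ x.2.1.length) :=
      primrec_pow.comp (Primrec.const 2) (Primrec.list_length.comp hs)
    have h4 : Primrec (fun x : (ℕ × ℕ) × (Str × (ℕ × List ℕ)) => 4 ^ (x.2.2.1 + 1)) :=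
      primrec_pow.comp (Primrec.const 4) (Primrec.succ.comp
        (Primrec.fst.comp (Primrec.snd.comp Primrec.snd)))
    have hr : Primrec (fun x : (ℕ × ℕ) × (Str × (ℕ × List ℕ)) => x.2.2.2.sum) :=
      primrec_sum.comp (Primrec.snd.comp (Primrec.snd.comp Primrec.snd))
    exact Primrec.nat_lt.comp
      (Primrec.nat_mul.comp (Primrec.nat_add.comp (Primrec.nat_mul.comp (Primrec.const k) h2)
        (primrec_strVal.comp hs)) h4)
      (Primrec.nat_add.comp (Primrec.nat_mul.comp hr h2) h4)

/-- The witness coded by a natural number. -/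
def wit (n : ℕ) : ℕ × List ℕ := Denumerable.ofNat (ℕ × List ℕ) n

open Classical in
/-- The test as a boolean function. -/
noncomputable def testB (c : Code) (k : ℕ) (g : ℕ → ℕ × ℕ) (σ : Str) (n : ℕ) : Bool :=
  decide (TestOK c k (g (wit n).1, (σ, wit n)))

theorem computable_testB (c : Code) (k : ℕ) (g : ℕ → ℕ × ℕ) (hg : Computable g) :
    Computable₂ (testB c k g) := by
  classical
  have hw : Computable (fun x : Str × ℕ => wit x.2) :=
    ((Primrec.ofNat (ℕ × List ℕ)).to_comp).comp Computable.snd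
  have h := (primrec_testOK c k).decide.to_comp.comp
    ((hg.comp (Computable.fst.comp hw)).pair (Computable.fst.pair hw))
  refine Computable.of_eq h (fun x => ?_)
  simp only [testB]

/-- The length of a string that is not produced by any program before stage `t`. -/
def outLen (c : Code) (t : ℕ) : ℕ :=
  ((List.range t).map (fun j => (Code.evaln t c j).getD 0)).sum + 1

/-- A string that is not produced by any program before stage `t`. -/
def outStr (c : Code) (t : ℕ) : Str := (List.range (outLen c t)).map (fun _ => true)

theorem primrec_outStr (c : Code) : Primrec (outStr c) := by
  have he : Primrec₂ (fun (t : ℕ) (j : ℕ) => (Code.evaln t c j).getD 0) :=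
    Primrec.option_getD.comp
      (Code.primrec_evaln.comp ((Primrec.fst.pair (Primrec.const c)).pair Primrec.snd))
      (Primrec.const 0)
  have h1 : Primrec (outLen c) :=
    Primrec.succ.comp (primrec_sum.comp (Primrec.list_map Primrec.list_range he))
  exact Primrec.list_map (Primrec.list_range.comp h1) (Primrec.const true).to₂

theorem outStr_late {C : Computer} {c : Code} (hc : IsCodeOf c C) (t : ℕ) (p : Str)
    (hp : outStr c t ∈ C.f p) : p ∉ haltSet c t := by
  intro h
  rw [mem_haltSet] at h
  obtain ⟨v, hv⟩ := Option.isSome_iff_exists.1 h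
  obtain ⟨s, hs, hsv⟩ := (hc p v).1 (Code.evaln_sound (Option.mem_def.2 hv))
  have hs' : s = outStr c t := Part.mem_unique hs hp
  have hlt : Encodable.encode p < t := Code.evaln_bound (Option.mem_def.2 hv)
  have h1 : v ≤ ((List.range t).map (fun j => (Code.evaln t c j).getD 0)).sum := by
    rw [sum_map_range]
    have := Finset.single_le_sum (f := fun j => (Code.evaln t c j).getD 0)
      (fun _ _ => Nat.zero_le _) (Finset.mem_range.2 hlt)
    simpa [hv] using this
  have h2 := length_le_encode s
  rw [hsv, hs'] at h2
  simp only [outStr, List.length_map, List.length_range, outLen] at h2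
  omega

/-- The machine. -/
noncomputable def beatComputer (U : Computer) (c : Code) (k : ℕ) (g : ℕ → ℕ × ℕ)
    (hg : Computable g) : Computer where
  f := fun p => (U.f p).bind (fun σ =>
    (Nat.rfind (fun n => (Part.some (testB c k g σ n)))).map (fun n => outStr c (wit n).1))
  partrec := by
    refine Partrec.bind U.partrec ?_
    have h1 : Partrec (fun σ : Str => Nat.rfind (fun n => (Part.some (testB c k g σ n)))) :=
      Partrec.rfind (computable_testB c k g hg).partrec₂
    have h2 : Partrec (fun σ : Str =>
        (Nat.rfind (fun n => (Part.some (testB c k g σ n)))).map (fun n => outStr c (wit n).1)) := by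
      refine h1.map ?_
      exact ((primrec_outStr c).to_comp.comp (Computable.fst.comp
        (((Primrec.ofNat (ℕ × List ℕ)).to_comp).comp Computable.snd))).to₂
    exact (h2.comp Computable.snd).to₂
  prefixFree := by
    intro p q hp hq h
    exact U.prefixFree p q (Part.Dom.of_bind hp) (Part.Dom.of_bind hq) h

theorem random (U : OptimalComputer) {c : Code} (hc : IsCodeOf c U.toComputer) {q : ℝ}
    (hq : 1 < q) (hqc : ComputableReal q) :
    ∃ d : ℕ, ∀ n : ℕ, (n : ℝ) - d ≤ Kc U (binPrefix (∑' i, xl c i ^ q) n) := by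
  obtain ⟨g, hg, hg0, hgq, hgl⟩ := exists_upper_approx q hq hqc
  set T := ∑' i, xl c i ^ q with hT
  have hT0 : 0 ≤ T := tsum_nonneg (fun i => Real.rpow_nonneg (xl_nonneg hc i) q)
  set k := ⌊T⌋₊ with hk
  obtain ⟨sim, hsim⟩ := U.optimal (beatComputer U.toComputer c k g hg)
  obtain ⟨e, he⟩ := pow_unbounded_of_one_lt ((4 : ℝ) ^ q) (show (1 : ℝ) < 2 by norm_num)
  refine ⟨e + 1 + sim, fun n => ?_⟩
  set σ := binPrefix T n with hσ
  have hσl : σ.length = n := length_binPrefix T n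
  obtain ⟨hv1, hv2⟩ := strVal_bounds T hT0 n
  obtain ⟨p, hpl, hpσ⟩ := exists_minimal U σ
  have h2n : (0 : ℝ) < 2 ^ n := by positivity
  -- the search succeeds
  have hex : ∃ w, testB c k g σ w = true := by
    obtain ⟨t, rs, hroot, hsum⟩ := root_complete hc hq hg0 hgl
      (show (0 : ℝ) < 1 / 2 ^ n by positivity)
    refine ⟨Encodable.encode (t, rs), ?_⟩
    have hw : wit (Encodable.encode (t, rs)) = (t, rs) := Denumerable.ofNat_encode _
    simp only [testB, hw, decide_eq_true_eq]
    refine ⟨hroot, ?_⟩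
    simp only [hσl]
    have h4 : (0 : ℝ) < 4 ^ (t + 1) := by positivity
    have h5 : (k : ℝ) * 2 ^ n + strVal σ < (rs.sum : ℝ) / 4 ^ (t + 1) * 2 ^ n + 1 := by
      have h6 := mul_lt_mul_of_pos_right hsum h2n
      rw [sub_mul, one_div, inv_mul_cancel₀ h2n.ne'] at h6
      linarith
    have h7 := mul_lt_mul_of_pos_right h5 h4
    have h8 : ((rs.sum : ℝ) / 4 ^ (t + 1) * 2 ^ n + 1) * 4 ^ (t + 1) =
        rs.sum * 2 ^ n + 4 ^ (t + 1) := by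
      field_simp
    rw [h8] at h7
    exact_mod_cast h7
  have hdom : (Nat.rfind (fun n => (Part.some (testB c k g σ n)))).Dom := by
    obtain ⟨w, hw⟩ := hex
    refine Nat.rfind_dom.2 ⟨w, ?_, fun _ => trivial⟩
    show true ∈ Part.some (testB c k g σ w)
    rw [hw]
    exact Part.mem_some _
  obtain ⟨w, hw⟩ := Part.dom_iff_mem.1 hdom
  have hout : outStr c (wit w).1 ∈ (beatComputer U.toComputer c k g hg).f p := by
    refine Part.mem_bind hpσ ?_
    exact Part.mem_map _ hw
  have htest : TestOK c k (g (wit w).1, (σ, wit w)) := by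
    have := Nat.rfind_spec hw
    rw [Part.mem_some_iff] at this
    have h' := this.symm
    simpa only [testB, decide_eq_true_eq] using h'
  obtain ⟨p', hp', hl'⟩ := hsim p _ hout
  have hlate := outStr_late hc (wit w).1 p' hp'
  obtain ⟨hroot, hbig⟩ := htest
  simp only [hσl] at hroot hbig
  have hS := root_sound hc hq (hg0 _) (hgq _) hroot
  set t := (wit w).1
  set rs := (wit w).2
  have h4 : (0 : ℝ) < 4 ^ (t + 1) := by positivity
  have hbig' : ((k : ℝ) * 2 ^ n + strVal σ) * 4 ^ (t + 1) < rs.sum * 2 ^ n + 4 ^ (t + 1) := by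
    exact_mod_cast hbig
  have hb2 : (k : ℝ) * 2 ^ n + strVal σ < (rs.sum : ℝ) / 4 ^ (t + 1) * 2 ^ n + 1 := by
    have h8 : ((rs.sum : ℝ) / 4 ^ (t + 1) * 2 ^ n + 1) * 4 ^ (t + 1) =
        rs.sum * 2 ^ n + 4 ^ (t + 1) := by
      field_simp
    rw [← h8] at hbig'
    exact lt_of_mul_lt_mul_right hbig' h4.le
  have hd : T - (rs.sum : ℝ) / 4 ^ (t + 1) < 2 / 2 ^ n := by
    rw [lt_div_iff₀ h2n, sub_mul]
    linarith
  have hfin := late_bound hc hq (Part.dom_iff_mem.2 ⟨_, hp'⟩) hlate hS hd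
  have h9 : (1 / 2 : ℝ) ^ p'.length ≤ 2 ^ e * (2 / 2 ^ n) :=
    le_trans hfin (mul_le_mul_of_nonneg_right he.le (by positivity))
  have h10 : (2 : ℝ) ^ n ≤ 2 ^ (e + 1 + p'.length) := by
    have h11 : (2 : ℝ) ^ e * (2 / 2 ^ n) = 2 ^ (e + 1) / 2 ^ n := by rw [pow_succ]; ring
    rw [h11, one_div, inv_pow, ← one_div, div_le_div_iff₀ (by positivity) h2n, one_mul] at h9
    rw [pow_add _ (e + 1)]
    exact h9
  have h12 : n ≤ e + 1 + p'.length := (pow_le_pow_iff_right₀ (by norm_num)).1 h10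
  have h13 : n ≤ e + 1 + (Kc U σ + sim) := by omega
  have h14 : (n : ℝ) ≤ e + 1 + (Kc U σ + sim) := by exact_mod_cast h13
  push_cast
  linarith

/-- There is a universal probability `m` such that for every computable real `q > 1`,
the power sum `∑ s, m s ^ q` is weakly Chaitin random and hence not
`1/q`-compressible. -/
theorem exists_universal_power_sum_random (U : OptimalComputer) :
    ∃ m : Str → ℝ, UniversalProb m ∧
      ∀ q : ℝ, 1 < q → ComputableReal q →
        (∃ c : ℕ, ∀ n : ℕ, (n : ℝ) - c ≤ Kc U (binPrefix (∑' s, m s ^ q) n)) ∧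
        ¬ DCompressible U (1 / q) (∑' s, m s ^ q) := by
  obtain ⟨c, hc⟩ := exists_isCodeOf U.toComputer
  refine ⟨mU c, mU_universal hc, fun q hq hqc => ?_⟩
  rw [tsum_mU hc hq]
  have h := random U hc hq hqc
  exact ⟨h, not_compressible U _ q hq h⟩

end Paper
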